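/- (Corollary 3.5) Assume Ideal[c_E] + QM[c_I] is Archimedean, K is nonempty, and f_max equals the γ-program value f_γ, with the infimum defining f_γ attained at a real vector (γ̂_1,…,γ̂_m). Then f_mom,k → f_max as k → ∞. -/

import Mathlib

open MvPolynomial Finset Filter Topology

noncomputable section

/-- Extended-real logarithm with the convention `log t = -∞` for `t ≤ 0`. -/
def elog (t : ℝ) : EReal := if 0 < t then ((Real.log t : ℝ) : EReal) else ⊥

/-- The degree `|α|` of a multi-index `α`. -/
def mdeg {n : ℕ} (α : Fin n →₀ ℕ) : ℕ := ∑ i, α i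

/-- The monomial vector `[x]_{2d}`, modeled as the function on multi-indices
whose `α`-entry is `x^α` for `|α| ≤ 2d` (and `0` above the truncation degree). -/
def monoVec {n : ℕ} (d : ℕ) (x : Fin n → ℝ) : (Fin n →₀ ℕ) → ℝ :=
  fun α => if mdeg α ≤ 2 * d then ∏ i, x i ^ α i else 0

/-- The pairing `⟨p, z⟩ = ∑_α p_α z_α`. -/
def pairing {n : ℕ} (p : MvPolynomial (Fin n) ℝ) (z : (Fin n →₀ ℕ) → ℝ) : ℝ :=
  ∑ α ∈ p.support, p.coeff α * z α

/-- The moment cone `R_d(S)`. -/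
def momentCone {n : ℕ} (d : ℕ) (S : Set (Fin n → ℝ)) : Set ((Fin n →₀ ℕ) → ℝ) :=
  {z | ∃ (l : ℕ) (lam : Fin l → ℝ) (v : Fin l → (Fin n → ℝ)),
    (∀ j, 0 ≤ lam j) ∧ (∀ j, v j ∈ S) ∧ z = ∑ j, lam j • monoVec d (v j)}

/-- `⌈t/2⌉` for a natural number `t`. -/
def ceilHalf (t : ℕ) : ℕ := (t + 1) / 2

/-- The objective `f(x) = ∑ᵢ aᵢ log pᵢ(x)` (with `log 0 = -∞`). -/
def fObj {n m : ℕ} (a : Fin m → ℝ) (p : Fin m → MvPolynomial (Fin n) ℝ)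
    (x : Fin n → ℝ) : EReal :=
  ∑ i, (a i : EReal) * elog (eval x (p i))

/-- `f_max`, the optimal value of the log-polynomial optimization problem. -/
def fMax {n m : ℕ} (a : Fin m → ℝ) (p : Fin m → MvPolynomial (Fin n) ℝ)
    (K : Set (Fin n → ℝ)) : EReal :=
  sSup (fObj a p '' K)

/-- The moment objective `∑ᵢ aᵢ log ⟨pᵢ, z⟩`. -/
def objVal {n m : ℕ} (a : Fin m → ℝ) (p : Fin m → MvPolynomial (Fin n) ℝ)
    (z : (Fin n →₀ ℕ) → ℝ) : EReal :=
  ∑ i, (a i : EReal) * elog (pairing (p i) z)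

/-- `f_mom`, the optimal value of the convex relaxation over `R_d(S) ∩ {z₀ = 1}`. -/
def fMom {n m : ℕ} (d : ℕ) (a : Fin m → ℝ) (p : Fin m → MvPolynomial (Fin n) ℝ)
    (S : Set (Fin n → ℝ)) : EReal :=
  sSup (objVal a p '' {z ∈ momentCone d S | z 0 = 1})

/-- `M_k[y] ⪰ 0`, encoded via quadratic forms whose coefficient vectors are
coefficient vectors of polynomials of degree at most `k`. -/
def momMatPSD {n : ℕ} (k : ℕ) (y : (Fin n →₀ ℕ) → ℝ) : Prop :=
  ∀ q : MvPolynomial (Fin n) ℝ, q.totalDegree ≤ k →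
    0 ≤ ∑ α ∈ q.support, ∑ β ∈ q.support, q.coeff α * q.coeff β * y (α + β)

/-- The `(α,β)` entry of the localizing matrix `L_c^{(k)}[y]`. -/
def locEntry {n : ℕ} (c : MvPolynomial (Fin n) ℝ) (y : (Fin n →₀ ℕ) → ℝ)
    (α β : Fin n →₀ ℕ) : ℝ :=
  ∑ γ ∈ c.support, c.coeff γ * y (γ + α + β)

/-- `L_c^{(k)}[y] = 0`. -/
def locMatZero {n : ℕ} (c : MvPolynomial (Fin n) ℝ) (k : ℕ)
    (y : (Fin n →₀ ℕ) → ℝ) : Prop :=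
  ∀ α β : Fin n →₀ ℕ, mdeg α ≤ k - ceilHalf c.totalDegree →
    mdeg β ≤ k - ceilHalf c.totalDegree → locEntry c y α β = 0

/-- `L_c^{(k)}[y] ⪰ 0`. -/
def locMatPSD {n : ℕ} (c : MvPolynomial (Fin n) ℝ) (k : ℕ)
    (y : (Fin n →₀ ℕ) → ℝ) : Prop :=
  ∀ q : MvPolynomial (Fin n) ℝ, q.totalDegree ≤ k - ceilHalf c.totalDegree →
    0 ≤ ∑ α ∈ q.support, ∑ β ∈ q.support, q.coeff α * q.coeff β * locEntry c y α β

/-- Feasibility for the `k`-th order moment relaxation with equality constraint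
polynomials `Eqs` and inequality constraint polynomials `Ineqs`. -/
def momFeasible {n : ℕ} (Eqs Ineqs : Set (MvPolynomial (Fin n) ℝ)) (k : ℕ)
    (y : (Fin n →₀ ℕ) → ℝ) : Prop :=
  y 0 = 1 ∧ momMatPSD k y ∧ (∀ c ∈ Eqs, locMatZero c k y) ∧ ∀ c ∈ Ineqs, locMatPSD c k y

/-- `f_mom,k`, the optimal value of the `k`-th order moment relaxation. -/
def fMomK {n m : ℕ} (a : Fin m → ℝ) (p : Fin m → MvPolynomial (Fin n) ℝ)
    (Eqs Ineqs : Set (MvPolynomial (Fin n) ℝ)) (k : ℕ) : EReal :=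
  sSup (objVal a p '' {y | momFeasible Eqs Ineqs k y})

/-- The value `f_γ` of the γ-program. -/
def fGamma {n m : ℕ} (a : Fin m → ℝ) (p : Fin m → MvPolynomial (Fin n) ℝ)
    (K : Set (Fin n → ℝ)) : EReal :=
  sInf {e : EReal | ∃ γ : Fin m → ℝ,
    (∀ i, ∀ x ∈ K, (a i : EReal) * elog (eval x (p i)) ≤ ((γ i : ℝ) : EReal)) ∧
    e = ((∑ i, γ i : ℝ) : EReal)}

/-- A polynomial is a sum of squares. -/
def IsSOSPoly {n : ℕ} (σ : MvPolynomial (Fin n) ℝ) : Prop :=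
  ∃ (t : ℕ) (r : Fin t → MvPolynomial (Fin n) ℝ), σ = ∑ j, (r j) ^ 2

/-- The set `Ideal[c_E] + QM[c_I]`. -/
def idealQM {n : ℕ} {ι : Type*} (E I : Finset ι) (c : ι → MvPolynomial (Fin n) ℝ) :
    Set (MvPolynomial (Fin n) ℝ) :=
  {q | ∃ (h : ι → MvPolynomial (Fin n) ℝ) (σ0 : MvPolynomial (Fin n) ℝ)
      (σ : ι → MvPolynomial (Fin n) ℝ),
    IsSOSPoly σ0 ∧ (∀ j ∈ I, IsSOSPoly (σ j)) ∧
    q = (∑ j ∈ E, h j * c j) + σ0 + ∑ j ∈ I, σ j * c j}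

/-- A quadratic module of a commutative ring. -/
structure IsQuadModule {A : Type*} [CommRing A] (Q : Set A) : Prop where
  one_mem : (1 : A) ∈ Q
  add_mem : ∀ {a b}, a ∈ Q → b ∈ Q → a + b ∈ Q
  sq_mul_mem : ∀ (a) {q}, q ∈ Q → a ^ 2 * q ∈ Q

namespace IsQuadModule

variable {A : Type*} [CommRing A] {Q : Set A}

theorem zero_mem (hQ : IsQuadModule Q) : (0 : A) ∈ Q := by
  simpa using hQ.sq_mul_mem 0 hQ.one_mem

theorem sq_mem (hQ : IsQuadModule Q) (a : A) : a ^ 2 ∈ Q := by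
  simpa using hQ.sq_mul_mem a hQ.one_mem

theorem isSumSq_mul_mem (hQ : IsQuadModule Q) {s q : A} (hs : IsSumSq s) (hq : q ∈ Q) :
    s * q ∈ Q := by
  induction hs with
  | zero => simpa using hQ.zero_mem
  | sq_add a _ ih =>
    have := hQ.add_mem (hQ.sq_mul_mem a hq) ih
    rwa [sq, ← add_mul] at this

theorem isSumSq_mem (hQ : IsQuadModule Q) {s : A} (hs : IsSumSq s) : s ∈ Q := by
  simpa using hQ.isSumSq_mul_mem hs hQ.one_mem

/-- Any quadratic module omitting `-1` is contained in a maximal one. -/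
theorem exists_le_maximal (hQ : IsQuadModule Q) (h1 : (-1 : A) ∉ Q) :
    ∃ P, Q ⊆ P ∧ Maximal (fun P : Set A => IsQuadModule P ∧ (-1 : A) ∉ P) P := by
  apply zorn_subset_nonempty {P : Set A | IsQuadModule P ∧ (-1 : A) ∉ P}
  · intro c hc hchain hne
    refine ⟨⋃₀ c, ⟨⟨?_, ?_, ?_⟩, ?_⟩, fun s hs => Set.subset_sUnion_of_mem hs⟩
    · obtain ⟨s, hs⟩ := hne
      exact ⟨s, hs, (hc hs).1.one_mem⟩
    · rintro a b ⟨s, hs, ha⟩ ⟨t, ht, hb⟩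
      rcases hchain.total hs ht with h | h
      · exact ⟨t, ht, (hc ht).1.add_mem (h ha) hb⟩
      · exact ⟨s, hs, (hc hs).1.add_mem ha (h hb)⟩
    · rintro a q ⟨s, hs, hq⟩
      exact ⟨s, hs, (hc hs).1.sq_mul_mem a hq⟩
    · rintro ⟨s, hs, h⟩
      exact (hc hs).2 h
  · exact ⟨hQ, h1⟩

/-- The quadratic module generated by `Q` and one more element. -/
theorem adjoin (hQ : IsQuadModule Q) (a : A) :
    IsQuadModule {x | ∃ q ∈ Q, ∃ s, IsSumSq s ∧ x = q + s * a} where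
  one_mem := ⟨1, hQ.one_mem, 0, .zero, by ring⟩
  add_mem := by
    rintro _ _ ⟨q, hq, s, hs, rfl⟩ ⟨q', hq', s', hs', rfl⟩
    exact ⟨q + q', hQ.add_mem hq hq', s + s', hs.add hs', by ring⟩
  sq_mul_mem := by
    rintro b _ ⟨q, hq, s, hs, rfl⟩
    exact ⟨b ^ 2 * q, hQ.sq_mul_mem b hq, b ^ 2 * s, (sq b ▸ IsSumSq.mul_self b).mul hs, by ring⟩

theorem exists_of_maximal_of_notMem {P : Set A}
    (hP : Maximal (fun P : Set A => IsQuadModule P ∧ (-1 : A) ∉ P) P) {a : A} (ha : a ∉ P) :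
    ∃ q ∈ P, ∃ s, IsSumSq s ∧ -1 = q + s * a := by
  by_contra h
  have := hP.2 ⟨hP.1.1.adjoin a, h⟩ (fun q hq => ⟨q, hq, 0, .zero, by ring⟩)
  exact ha (this ⟨0, hP.1.1.zero_mem, 1, by simp, by ring⟩)

variable [Algebra ℝ A]

theorem algebraMap_mul_mem (hQ : IsQuadModule Q) {r : ℝ} (hr : 0 ≤ r) {q : A} (hq : q ∈ Q) :
    algebraMap ℝ A r * q ∈ Q := by
  have := hQ.sq_mul_mem (algebraMap ℝ A √r) hq
  rwa [← map_pow, Real.sq_sqrt hr] at this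

theorem algebraMap_mem (hQ : IsQuadModule Q) {r : ℝ} (hr : 0 ≤ r) : algebraMap ℝ A r ∈ Q := by
  simpa using hQ.algebraMap_mul_mem hr hQ.one_mem

theorem nonneg_of_algebraMap_mem (hQ : IsQuadModule Q) (h1 : (-1 : A) ∉ Q) {r : ℝ}
    (h : algebraMap ℝ A r ∈ Q) : 0 ≤ r := by
  by_contra! hr
  apply h1
  have := hQ.algebraMap_mul_mem (r := -r⁻¹) (by simpa using hr.le) h
  rwa [← map_mul, neg_mul, inv_mul_cancel₀ hr.ne, map_neg, map_one] at this

theorem mem_of_algebraMap_mul_mem (hQ : IsQuadModule Q) {r : ℝ} (hr : 0 < r) {a : A}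
    (h : algebraMap ℝ A r * a ∈ Q) : a ∈ Q := by
  have := hQ.algebraMap_mul_mem (inv_nonneg.2 hr.le) h
  rwa [← mul_assoc, ← map_mul, inv_mul_cancel₀ hr.ne', map_one, one_mul] at this

/-- A product of two elements lies in a quadratic module as soon as both factors do and their
sum is a positive constant. -/
theorem mul_mem_of_add_eq (hQ : IsQuadModule Q) {r : ℝ} (hr : 0 < r) {a b : A}
    (ha : a ∈ Q) (hb : b ∈ Q) (hab : a + b = algebraMap ℝ A r) : a * b ∈ Q := by
  apply hQ.mem_of_algebraMap_mul_mem hr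
  have := hQ.add_mem (hQ.sq_mul_mem a hb) (hQ.sq_mul_mem b ha)
  rw [← hab]
  convert this using 1
  ring

theorem mul_mem_support (hQ : IsQuadModule Q) {a : A} (ha : a ∈ Q) (ha' : -a ∈ Q) (b : A) :
    a * b ∈ Q := by
  apply hQ.mem_of_algebraMap_mul_mem (r := 4) (by norm_num)
  have := hQ.add_mem (hQ.sq_mul_mem (b + 1) ha) (hQ.sq_mul_mem (b - 1) ha')
  convert this using 1
  rw [map_ofNat]
  ring

theorem mem_or_neg_mem_of_maximal {P : Set A}
    (hP : Maximal (fun P : Set A => IsQuadModule P ∧ (-1 : A) ∉ P) P) (a : A) :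
    a ∈ P ∨ -a ∈ P := by
  by_contra! h
  obtain ⟨q₁, hq₁, s₁, hs₁, h₁⟩ := exists_of_maximal_of_notMem hP h.1
  obtain ⟨q₂, hq₂, s₂, hs₂, h₂⟩ := exists_of_maximal_of_notMem hP h.2
  have hQ := hP.1.1
  have hs : -s₁ ∈ P := by
    have := hQ.add_mem (hQ.add_mem (hQ.isSumSq_mem hs₂) (hQ.isSumSq_mul_mem hs₂ hq₁))
      (hQ.isSumSq_mul_mem hs₁ hq₂)
    convert this using 1
    linear_combination s₂ * h₁ + s₁ * h₂
  apply hP.1.2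
  rw [h₁]
  exact hQ.add_mem hq₁ (hQ.mul_mem_support (hQ.isSumSq_mem hs₁) hs a)

/-- An Archimedean total proper quadratic module is the nonnegativity cone of a character. -/
theorem exists_algHom_of_total (hQ : IsQuadModule Q) (h1 : (-1 : A) ∉ Q)
    (harch : ∀ a : A, ∃ r : ℝ, algebraMap ℝ A r - a ∈ Q) (htot : ∀ a : A, a ∈ Q ∨ -a ∈ Q) :
    ∃ χ : A →ₐ[ℝ] ℝ, ∀ q ∈ Q, 0 ≤ χ q := by
  let U : A → Set ℝ := fun a => {r | algebraMap ℝ A r - a ∈ Q}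
  let χ : A → ℝ := fun a => sInf (U a)
  have hmono {r s : ℝ} {a b : A} (hr : algebraMap ℝ A r - a ∈ Q)
      (hs : b - algebraMap ℝ A s ∈ Q) (hab : a - b ∈ Q) : s ≤ r := by
    have := hQ.nonneg_of_algebraMap_mem h1 (r := r - s)
      (by convert hQ.add_mem (hQ.add_mem hr hs) hab using 1; rw [map_sub]; ring)
    linarith
  have hne (a) : (U a).Nonempty := harch a
  have hbdd (a) : BddBelow (U a) := by
    obtain ⟨N, hN⟩ := harch (-a)
    refine ⟨-N, fun r hr => hmono (a := a) (b := a) hr ?_ (by simpa using hQ.zero_mem)⟩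
    convert hN using 1
    rw [map_neg]; ring
  have hgt {a} {r : ℝ} (hr : χ a < r) : algebraMap ℝ A r - a ∈ Q := by
    obtain ⟨s, hs, hsr⟩ := exists_lt_of_csInf_lt (hne a) hr
    convert hQ.add_mem hs (hQ.algebraMap_mem (sub_nonneg.2 hsr.le)) using 1
    rw [map_sub]; ring
  have hlt {a} {r : ℝ} (hr : r < χ a) : a - algebraMap ℝ A r ∈ Q := by
    rcases htot (algebraMap ℝ A r - a) with h | h
    · exact absurd (csInf_le (hbdd a) h) (not_le.2 hr)
    · simpa using h
  have hle {a} {r : ℝ} (h : algebraMap ℝ A r - a ∈ Q) : χ a ≤ r := csInf_le (hbdd a) h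
  have hge {a} {r : ℝ} (h : a - algebraMap ℝ A r ∈ Q) : r ≤ χ a :=
    le_csInf (hne a) fun s hs => hmono (a := a) (b := a) hs h (by simpa using hQ.zero_mem)
  have hconst (r : ℝ) : χ (algebraMap ℝ A r) = r :=
    le_antisymm (hle (by simpa using hQ.zero_mem)) (hge (by simpa using hQ.zero_mem))
  have hadd (a b) : χ (a + b) = χ a + χ b := by
    apply le_antisymm
    · refine le_of_forall_pos_le_add fun ε hε => ?_
      have := hle (a := a + b) (r := (χ a + ε / 2) + (χ b + ε / 2)) (by
        convert hQ.add_mem (hgt (a := a) (r := χ a + ε / 2) (by linarith))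
          (hgt (a := b) (r := χ b + ε / 2) (by linarith)) using 1
        rw [map_add]; ring)
      linarith
    · refine le_of_forall_pos_le_add fun ε hε => ?_
      have := hge (a := a + b) (r := (χ a - ε / 2) + (χ b - ε / 2)) (by
        convert hQ.add_mem (hlt (a := a) (r := χ a - ε / 2) (by linarith))
          (hlt (a := b) (r := χ b - ε / 2) (by linarith)) using 1
        rw [map_add]; ring)
      linarith
  have hzero : χ 0 = 0 := by simpa using hconst 0
  have hneg (a) : χ (-a) = - χ a := by
    have := hadd a (-a)
    rw [add_neg_cancel, hzero] at this
    linarith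
  have hsmul_le {c : ℝ} (hc : 0 < c) (a) : χ (algebraMap ℝ A c * a) ≤ c * χ a := by
    refine le_of_forall_pos_le_add fun ε hε => ?_
    have := hle (a := algebraMap ℝ A c * a) (r := c * (χ a + ε / c)) (by
      convert hQ.algebraMap_mul_mem hc.le
        (hgt (a := a) (r := χ a + ε / c) (by linarith [div_pos hε hc])) using 1
      rw [map_mul]; ring)
    rwa [mul_add, mul_div_cancel₀ _ hc.ne'] at this
  have hsmul_pos {c : ℝ} (hc : 0 < c) (a) : χ (algebraMap ℝ A c * a) = c * χ a := by
    apply le_antisymm (hsmul_le hc a)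
    have := hsmul_le hc (-a)
    rw [mul_neg, hneg, hneg] at this
    linarith
  have hsmul (c : ℝ) (a) : χ (algebraMap ℝ A c * a) = c * χ a := by
    rcases lt_trichotomy c 0 with hc | rfl | hc
    · have := hsmul_pos (neg_pos.2 hc) a
      rw [map_neg, neg_mul, hneg] at this
      linarith
    · simp [hzero]
    · exact hsmul_pos hc a
  have hsq0 {a} (ha : χ a = 0) : χ (a * a) = 0 := by
    apply le_antisymm
    · refine le_of_forall_pos_le_add fun ε hε => ?_
      have hs : 0 < √ε := Real.sqrt_pos.2 hε
      have h₁ := hgt (a := a) (r := √ε) (by rwa [ha])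
      have h₂ := hlt (a := a) (r := -√ε) (by rw [ha]; linarith)
      have := hQ.mul_mem_of_add_eq (r := √ε + √ε) (by linarith) h₁ h₂
        (by rw [map_neg, map_add]; ring)
      rw [zero_add]
      apply hle
      convert this using 1
      nth_rw 1 [← Real.mul_self_sqrt hε.le]
      rw [map_mul, map_neg]; ring
    · apply hge
      simpa [sq] using hQ.sq_mem a
  have hsq (a) : χ (a * a) = χ a * χ a := by
    have h0 : χ (a - algebraMap ℝ A (χ a)) = 0 := by
      rw [sub_eq_add_neg, hadd, hneg, hconst]; ring
    have := hsq0 h0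
    rw [show (a - algebraMap ℝ A (χ a)) * (a - algebraMap ℝ A (χ a)) =
      a * a + (algebraMap ℝ A (-(2 * χ a)) * a + algebraMap ℝ A (χ a * χ a)) by
        simp only [map_neg, map_mul, map_ofNat]; ring, hadd, hadd, hsmul, hconst] at this
    linarith
  let F : A →+* ℝ := AddMonoidHom.mkRingHomOfMulSelfOfTwoNeZero
    { toFun := χ, map_zero' := hzero, map_add' := hadd } hsq two_ne_zero (by simpa using hconst 1)
  exact ⟨{ F with commutes' := hconst }, fun q hq => hge (r := 0) (by simpa using hq)⟩

/-- **Archimedean Positivstellensatz** for quadratic modules. -/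
theorem mem_of_forall_algHom_pos (hQ : IsQuadModule Q)
    (harch : ∀ a : A, ∃ r : ℝ, algebraMap ℝ A r - a ∈ Q) {f : A}
    (hf : ∀ χ : A →ₐ[ℝ] ℝ, (∀ q ∈ Q, 0 ≤ χ q) → 0 < χ f) : f ∈ Q := by
  have hcert : ∃ s, IsSumSq s ∧ s * f - 1 ∈ Q := by
    by_contra! h
    have h1 : (-1 : A) ∉ {x | ∃ q ∈ Q, ∃ s, IsSumSq s ∧ x = q + s * (-f)} := by
      rintro ⟨q, hq, s, hs, h'⟩
      refine h s hs ?_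
      convert hq using 1
      linear_combination h'
    obtain ⟨P, hle, hP⟩ := (hQ.adjoin (-f)).exists_le_maximal h1
    have hQP : Q ⊆ P := fun q hq => hle ⟨q, hq, 0, .zero, by ring⟩
    obtain ⟨χ, hχ⟩ := hP.1.1.exists_algHom_of_total hP.1.2
      (fun a => (harch a).imp fun r hr => hQP hr) (mem_or_neg_mem_of_maximal hP)
    have h2 := hf χ fun q hq => hχ q (hQP hq)
    have h3 := hχ (-f) (hle ⟨0, hQ.zero_mem, 1, by simp, by ring⟩)
    rw [map_neg] at h3
    linarith
  obtain ⟨s, hs, hsf⟩ := hcert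
  obtain ⟨k₁, hk₁⟩ := harch s
  obtain ⟨k₂, hk₂⟩ := harch (s ^ 2 * f + 1)
  obtain ⟨r₀, hr₀⟩ := harch (-f)
  obtain ⟨k, hk0, hk1, hk2⟩ : ∃ k : ℝ, 0 < k ∧ k₁ ≤ 2 * k ∧ k₂ ≤ 2 * k :=
    ⟨|k₁| + |k₂| + 1, by positivity, by linarith [le_abs_self k₁, abs_nonneg k₂, abs_nonneg k₁],
      by linarith [le_abs_self k₂, abs_nonneg k₁, abs_nonneg k₂]⟩
  have hks : algebraMap ℝ A (2 * k) - s ∈ Q := by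
    convert hQ.add_mem hk₁ (hQ.algebraMap_mem (sub_nonneg.2 hk1)) using 1
    rw [map_sub]; ring
  have hkf : algebraMap ℝ A (2 * k) - s ^ 2 * f - 1 ∈ Q := by
    convert hQ.add_mem hk₂ (hQ.algebraMap_mem (sub_nonneg.2 hk2)) using 1
    rw [map_sub]; ring
  have hss : s * (algebraMap ℝ A (2 * k) - s) ∈ Q :=
    hQ.mul_mem_of_add_eq (r := 2 * k) (by linarith) (hQ.isSumSq_mem hs) hks (by ring)
  have hstep {r : ℝ} (hr : 0 ≤ r) (h : algebraMap ℝ A r + f ∈ Q) :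
      algebraMap ℝ A (r - 1 / k ^ 2) + f ∈ Q := by
    apply hQ.mem_of_algebraMap_mul_mem (r := k ^ 2) (by positivity)
    have h₁ := hQ.sq_mul_mem (algebraMap ℝ A k - s) h
    have h₂ := hQ.algebraMap_mul_mem (r := 2 * k) (by linarith) hsf
    have h₃ := hQ.algebraMap_mul_mem hr hss
    convert hQ.add_mem (hQ.add_mem h₁ h₂) (hQ.add_mem h₃ hkf) using 1
    have : algebraMap ℝ A (k ^ 2) * algebraMap ℝ A (r - 1 / k ^ 2) =
        algebraMap ℝ A k ^ 2 * algebraMap ℝ A r - 1 := by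
      rw [← map_mul, ← map_pow, ← map_mul, ← map_one (algebraMap ℝ A), ← map_sub]
      congr 1
      field_simp
    rw [mul_add, this]
    simp only [map_mul, map_pow, map_ofNat]
    ring
  have hup {r r' : ℝ} (hr : r ≤ r') (h : algebraMap ℝ A r + f ∈ Q) : algebraMap ℝ A r' + f ∈ Q := by
    convert hQ.add_mem h (hQ.algebraMap_mem (sub_nonneg.2 hr)) using 1
    rw [map_sub]; ring
  have hmain (j : ℕ) : algebraMap ℝ A (max 0 (r₀ - j * (1 / k ^ 2))) + f ∈ Q := by
    induction j with
    | zero => exact hup (r := r₀) (by simp) (by rwa [sub_neg_eq_add] at hr₀)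
    | succ j ih =>
      refine hup ?_ (hstep (le_max_left _ _) ih)
      have hk' : 0 < 1 / k ^ 2 := by positivity
      push_cast
      rcases max_cases 0 (r₀ - j * (1 / k ^ 2)) with h | h <;> rw [h.1]
      · linarith [le_max_left 0 (r₀ - (j + 1) * (1 / k ^ 2))]
      · linarith [le_max_right 0 (r₀ - (j + 1) * (1 / k ^ 2))]
  obtain ⟨j, hj⟩ := exists_nat_gt (r₀ * k ^ 2)
  have := hmain j
  rw [max_eq_left] at this
  · simpa using this
  · have : r₀ < j / k ^ 2 := by rwa [lt_div_iff₀ (by positivity)]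
    rw [mul_one_div]; linarith

end IsQuadModule

/-- A preordering of a commutative ring, not required to be proper. -/
structure IsPreordering {A : Type*} [CommRing A] (T : Set A) : Prop where
  add_mem : ∀ {a b}, a ∈ T → b ∈ T → a + b ∈ T
  mul_mem : ∀ {a b}, a ∈ T → b ∈ T → a * b ∈ T
  sq_mem : ∀ a, a ^ 2 ∈ T

/-- A prime cone of a commutative ring, i.e. a point of its real spectrum. -/
structure IsPrimeCone {A : Type*} [CommRing A] (P : Set A) : Prop extends IsPreordering P where
  neg_one_notMem : (-1 : A) ∉ P
  mem_or_neg_mem : ∀ a, a ∈ P ∨ -a ∈ P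
  prime : ∀ {a b}, a * b ∈ P → -(a * b) ∈ P → (a ∈ P ∧ -a ∈ P) ∨ (b ∈ P ∧ -b ∈ P)

namespace IsPreordering

variable {A : Type*} [CommRing A] {T : Set A}

theorem zero_mem (hT : IsPreordering T) : (0 : A) ∈ T := by simpa using hT.sq_mem 0

theorem one_mem (hT : IsPreordering T) : (1 : A) ∈ T := by simpa using hT.sq_mem 1

/-- The preordering generated by `T` and one more element. -/
theorem adjoin (hT : IsPreordering T) (a : A) :
    IsPreordering {x | ∃ p ∈ T, ∃ q ∈ T, x = p + q * a} where
  add_mem := by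
    rintro _ _ ⟨p, hp, q, hq, rfl⟩ ⟨p', hp', q', hq', rfl⟩
    exact ⟨p + p', hT.add_mem hp hp', q + q', hT.add_mem hq hq', by ring⟩
  mul_mem := by
    rintro _ _ ⟨p, hp, q, hq, rfl⟩ ⟨p', hp', q', hq', rfl⟩
    exact ⟨p * p' + q * q' * a ^ 2,
      hT.add_mem (hT.mul_mem hp hp') (hT.mul_mem (hT.mul_mem hq hq') (hT.sq_mem a)),
      p * q' + q * p', hT.add_mem (hT.mul_mem hp hq') (hT.mul_mem hq hp'), by ring⟩
  sq_mem b := ⟨b ^ 2, hT.sq_mem b, 0, hT.zero_mem, by ring⟩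

theorem exists_of_maximal_of_notMem
    (hT : Maximal (fun P : Set A => IsPreordering P ∧ (-1 : A) ∉ P) T) {a : A} (ha : a ∉ T) :
    ∃ p ∈ T, ∃ q ∈ T, a * q = -(1 + p) := by
  by_contra! h
  have := hT.2 ⟨hT.1.1.adjoin a, ?_⟩ (fun q hq => ⟨q, hq, 0, hT.1.1.zero_mem, by ring⟩)
  · exact ha (this ⟨0, hT.1.1.zero_mem, 1, hT.1.1.one_mem, by ring⟩)
  · rintro ⟨p, hp, q, hq, h'⟩
    exact h p hp q hq (by linear_combination -h')

theorem isPrimeCone_of_maximal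
    (hT : Maximal (fun P : Set A => IsPreordering P ∧ (-1 : A) ∉ P) T) : IsPrimeCone T where
  toIsPreordering := hT.1.1
  neg_one_notMem := hT.1.2
  mem_or_neg_mem a := by
    by_contra! h
    obtain ⟨p, hp, q, hq, h₁⟩ := exists_of_maximal_of_notMem hT h.1
    obtain ⟨p', hp', q', hq', h₂⟩ := exists_of_maximal_of_notMem hT h.2
    apply hT.1.2
    have H := hT.1.1
    have := H.add_mem (H.add_mem hp hp') (H.add_mem (H.mul_mem hp hp')
      (H.mul_mem (H.sq_mem a) (H.mul_mem hq hq')))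
    convert this using 1
    linear_combination (-a * q') * h₁ - (1 + p) * h₂
  prime := by
    have H := hT.1.1
    have key {a b : A} (ha : a ∉ T) (hb : b ∉ T) (hab : -(a * b) ∈ T) : False := by
      obtain ⟨p, hp, q, hq, h₁⟩ := exists_of_maximal_of_notMem hT ha
      obtain ⟨p', hp', q', hq', h₂⟩ := exists_of_maximal_of_notMem hT hb
      apply hT.1.2
      have := H.add_mem (H.add_mem hp hp') (H.add_mem (H.mul_mem hp hp')
        (H.mul_mem hab (H.mul_mem hq hq')))
      convert this using 1
      linear_combination (b * q') * h₁ - (1 + p) * h₂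
    intro a b h h'
    by_contra! hc
    obtain ⟨h₁, h₂⟩ := hc
    have hna : ∃ a', a' ∉ T ∧ (a' = a ∨ a' = -a) := by
      by_cases ha : a ∈ T
      · exact ⟨-a, h₁ ha, .inr rfl⟩
      · exact ⟨a, ha, .inl rfl⟩
    have hnb : ∃ b', b' ∉ T ∧ (b' = b ∨ b' = -b) := by
      by_cases hb : b ∈ T
      · exact ⟨-b, h₂ hb, .inr rfl⟩
      · exact ⟨b, hb, .inl rfl⟩
    obtain ⟨a', ha', ha''⟩ := hna
    obtain ⟨b', hb', hb''⟩ := hnb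
    apply key ha' hb'
    rcases ha'' with rfl | rfl <;> rcases hb'' with rfl | rfl <;> simpa

theorem exists_isPrimeCone (hT : IsPreordering T) (h1 : (-1 : A) ∉ T) :
    ∃ P, T ⊆ P ∧ IsPrimeCone P := by
  suffices h : ∃ P, T ⊆ P ∧ Maximal (fun P : Set A => IsPreordering P ∧ (-1 : A) ∉ P) P from
    h.imp fun P hP => ⟨hP.1, isPrimeCone_of_maximal hP.2⟩
  apply zorn_subset_nonempty {P : Set A | IsPreordering P ∧ (-1 : A) ∉ P}
  · intro c hc hchain hne
    have hdir {a b} (ha : a ∈ ⋃₀ c) (hb : b ∈ ⋃₀ c) : ∃ s ∈ c, a ∈ s ∧ b ∈ s := by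
      obtain ⟨s, hs, ha⟩ := ha
      obtain ⟨t, ht, hb⟩ := hb
      rcases hchain.total hs ht with h | h
      · exact ⟨t, ht, h ha, hb⟩
      · exact ⟨s, hs, ha, h hb⟩
    refine ⟨⋃₀ c, ⟨⟨?_, ?_, ?_⟩, ?_⟩, fun s hs => Set.subset_sUnion_of_mem hs⟩
    · intro a b ha hb
      obtain ⟨s, hs, ha, hb⟩ := hdir ha hb
      exact ⟨s, hs, (hc hs).1.add_mem ha hb⟩
    · intro a b ha hb
      obtain ⟨s, hs, ha, hb⟩ := hdir ha hb
      exact ⟨s, hs, (hc hs).1.mul_mem ha hb⟩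
    · obtain ⟨s, hs⟩ := hne
      exact fun a => ⟨s, hs, (hc hs).1.sq_mem a⟩
    · rintro ⟨s, hs, h⟩
      exact (hc hs).2 h
  · exact ⟨hT, h1⟩

end IsPreordering

namespace IsPrimeCone

variable {A : Type*} [CommRing A] {P : Set A}

/-- The support `P ∩ -P` of a prime cone. -/
def support (hP : IsPrimeCone P) : Ideal A where
  carrier := {a | a ∈ P ∧ -a ∈ P}
  zero_mem' := ⟨hP.zero_mem, by simpa using hP.zero_mem⟩
  add_mem' := by
    rintro a b ⟨ha, ha'⟩ ⟨hb, hb'⟩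
    exact ⟨hP.add_mem ha hb, by simpa [add_comm] using hP.add_mem ha' hb'⟩
  smul_mem' := by
    rintro c a ⟨ha, ha'⟩
    rcases hP.mem_or_neg_mem c with h | h
    · exact ⟨hP.mul_mem h ha, by simpa using hP.mul_mem h ha'⟩
    · exact ⟨by simpa using hP.mul_mem h ha', by simpa using hP.mul_mem h ha⟩

theorem isPrime_support (hP : IsPrimeCone P) : hP.support.IsPrime where
  ne_top' h := hP.neg_one_notMem ((Ideal.eq_top_iff_one _).1 h).2
  mem_or_mem' h := hP.prime h.1 h.2

end IsPrimeCone

/-- The intermediate value property for polynomials over an ordered field. -/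
def HasPolyIVT (R : Type*) [Field R] [LinearOrder R] : Prop :=
  ∀ (f : Polynomial R) (a b : R), a < b → f.eval a * f.eval b < 0 →
    ∃ c, a < c ∧ c < b ∧ f.eval c = 0

namespace Polynomial

variable {L : Type*} [Field L] [LinearOrder L] [IsStrictOrderedRing L]

/-- Sums of squares with nonnegative constant weights of polynomials of degree less than `d`. -/
def weightedSumSq (L : Type*) [Field L] [LinearOrder L] [IsStrictOrderedRing L] (d : WithBot ℕ) :
    AddSubmonoid L[X] :=
  AddSubmonoid.closure {s | ∃ p : L, 0 ≤ p ∧ ∃ g : L[X], g.degree < d ∧ s = C p * g ^ 2}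

theorem eval_nonneg_of_mem_weightedSumSq {d : WithBot ℕ} {s : L[X]}
    (hs : s ∈ weightedSumSq L d) (x : L) : 0 ≤ s.eval x := by
  induction hs using AddSubmonoid.closure_induction with
  | mem s h =>
    obtain ⟨p, hp, g, -, rfl⟩ := h
    simpa using mul_nonneg hp (sq_nonneg _)
  | zero => simp
  | add s t _ _ hs ht => simpa using add_nonneg hs ht

theorem natDegree_le_of_mem_weightedSumSq {d : ℕ} {s : L[X]}
    (hs : s ∈ weightedSumSq L d) : s.natDegree ≤ 2 * (d - 1) := by
  induction hs using AddSubmonoid.closure_induction with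
  | mem s h =>
    obtain ⟨p, hp, g, hg, rfl⟩ := h
    have h1 : g.natDegree ≤ d - 1 := by
      rcases eq_or_ne g 0 with rfl | h0
      · simp
      · have := (natDegree_lt_iff_degree_lt h0).2 hg
        omega
    exact (natDegree_C_mul_le _ _).trans (natDegree_pow_le_of_le 2 h1)
  | zero => simp
  | add s t _ _ hs ht => exact natDegree_add_le_of_degree_le hs ht

/-- If the intermediate value property fails for `f`, with `f` of minimal degree, then `f` is
irreducible and the order of `L` extends to a prime cone of `L[X]` vanishing at `f`. -/
theorem exists_isPrimeCone_of_not_hasPolyIVT (h : ¬ HasPolyIVT L) :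
    ∃ f : L[X], Irreducible f ∧ (∀ x, f.eval x ≠ 0) ∧
      ∃ P : Set L[X], ∃ hP : IsPrimeCone P, f ∈ hP.support ∧ ∀ p : L, 0 ≤ p → C p ∈ P := by
  classical
  let Bad : ℕ → Prop := fun d => ∃ f : L[X], f.natDegree = d ∧ ∃ a b, a < b ∧
    f.eval a * f.eval b < 0 ∧ ∀ c, a < c → c < b → f.eval c ≠ 0
  have hex : ∃ d, Bad d := by
    simp only [HasPolyIVT] at h
    push Not at h
    obtain ⟨f, a, b, hab, hf, hc⟩ := h
    exact ⟨_, f, rfl, a, b, hab, hf, hc⟩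
  obtain ⟨f, hfd, a, b, hab, hf, hc⟩ := Nat.find_spec hex
  have hmin {g : L[X]} (hg : g.natDegree < f.natDegree) (hg' : g.eval a * g.eval b < 0) :
      ∃ c, a < c ∧ c < b ∧ g.eval c = 0 := by
    by_contra! hcon
    exact Nat.find_min hex (hfd ▸ hg) ⟨g, rfl, a, b, hab, hg', hcon⟩
  have hf0 : f ≠ 0 := by rintro rfl; simp at hf
  have hdeg : 0 < f.natDegree := by
    rw [Nat.pos_iff_ne_zero]
    intro h0
    rw [eq_C_of_natDegree_eq_zero h0] at hf
    simp only [eval_C] at hf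
    exact absurd hf (not_lt.2 (mul_self_nonneg _))
  have hirr : Irreducible f := by
    refine ⟨fun hu => ?_, fun g k hgk => ?_⟩
    · exact hdeg.ne' (natDegree_eq_zero_of_isUnit hu)
    · have hg0 : g ≠ 0 := by rintro rfl; simp [hf0] at hgk
      have hk0 : k ≠ 0 := by rintro rfl; simp [hf0] at hgk
      have hsum : f.natDegree = g.natDegree + k.natDegree := by rw [hgk, natDegree_mul hg0 hk0]
      by_contra! hcon
      have hg1 : g.natDegree ≠ 0 := fun h0 => hcon.1 (isUnit_iff_degree_eq_zero.2
        (by rw [degree_eq_natDegree hg0, h0]; rfl))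
      have hk1 : k.natDegree ≠ 0 := fun h0 => hcon.2 (isUnit_iff_degree_eq_zero.2
        (by rw [degree_eq_natDegree hk0, h0]; rfl))
      have hmul : (g.eval a * g.eval b) * (k.eval a * k.eval b) < 0 := by
        rw [hgk, eval_mul, eval_mul] at hf
        linarith
      rcases mul_neg_iff.1 hmul with ⟨-, h'⟩ | ⟨h', -⟩
      · obtain ⟨c, h1, h2, h3⟩ := hmin (by omega) h'
        exact hc c h1 h2 (by simp [hgk, h3])
      · obtain ⟨c, h1, h2, h3⟩ := hmin (by omega) h'
        exact hc c h1 h2 (by simp [hgk, h3])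
  have hroot (x : L) : f.eval x ≠ 0 := by
    intro hx
    obtain ⟨u, hu⟩ := dvd_iff_isRoot.2 hx
    rcases hirr.isUnit_or_isUnit hu with h' | h'
    · exact not_isUnit_X_sub_C x h'
    · obtain ⟨r, hr, rfl⟩ := isUnit_iff.1 h'
      have hr0 := hr.ne_zero
      rw [hu] at hf
      simp only [eval_mul, eval_sub, eval_X, eval_C] at hf
      have : (a - x) * (b - x) < 0 := by
        by_contra! hcon
        have := mul_nonneg hcon (mul_self_nonneg r)
        linarith
      rcases mul_neg_iff.1 this with ⟨h1, h2⟩ | ⟨h1, h2⟩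
      · linarith
      · exact hc x (by linarith) (by linarith) (by simp [hu])
  refine ⟨f, hirr, hroot, ?_⟩
  let T : Set L[X] := {x | ∃ s ∈ weightedSumSq L f.natDegree, ∃ u, x = s + f * u}
  have hsqmem {p : L} (hp : 0 ≤ p) (g : L[X]) : C p * g ^ 2 ∈ T := by
    refine ⟨C p * (g % f) ^ 2, AddSubmonoid.subset_closure ⟨p, hp, g % f, ?_, rfl⟩,
      C p * (g / f) * (g + g % f), ?_⟩
    · rw [← degree_eq_natDegree hf0]
      exact EuclideanDomain.mod_lt g hf0
    · linear_combination -(C p) * (g + g % f) * EuclideanDomain.mod_add_div g f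
  have hadd {x y : L[X]} (hx : x ∈ T) (hy : y ∈ T) : x + y ∈ T := by
    obtain ⟨s, hs, u, rfl⟩ := hx
    obtain ⟨t, ht, v, rfl⟩ := hy
    exact ⟨s + t, add_mem hs ht, u + v, by ring⟩
  have hmul {s t : L[X]} (hs : s ∈ weightedSumSq L f.natDegree)
      (ht : t ∈ weightedSumSq L f.natDegree) : s * t ∈ T := by
    induction hs, ht using AddSubmonoid.closure_induction₂ with
    | mem s t hs ht =>
      obtain ⟨p, hp, g, -, rfl⟩ := hs
      obtain ⟨q, hq, k, -, rfl⟩ := ht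
      convert hsqmem (mul_nonneg hp hq) (g * k) using 1
      rw [C_mul]; ring
    | zero_left => exact ⟨0, zero_mem _, 0, by ring⟩
    | zero_right => exact ⟨0, zero_mem _, 0, by ring⟩
    | add_left _ _ _ _ _ _ h1 h2 => rw [add_mul]; exact hadd h1 h2
    | add_right _ _ _ _ _ _ h1 h2 => rw [mul_add]; exact hadd h1 h2
  have hT : IsPreordering T := by
    refine ⟨hadd, ?_, fun g => by simpa using hsqmem zero_le_one g⟩
    rintro _ _ ⟨s, hs, u, rfl⟩ ⟨t, ht, v, rfl⟩
    obtain ⟨r, hr, w, hw⟩ := hmul hs ht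
    exact ⟨r, hr, w + s * v + u * t + f * u * v, by linear_combination hw⟩
  have h1 : (-1 : L[X]) ∉ T := by
    rintro ⟨s, hs, u, hu⟩
    have hev (x : L) : f.eval x * u.eval x < 0 := by
      have := congrArg (eval x) hu
      simp only [eval_neg, eval_one, eval_add, eval_mul] at this
      linarith [eval_nonneg_of_mem_weightedSumSq hs x]
    have hfu : f * u = -(1 + s) := by linear_combination -hu
    have hu0 : u ≠ 0 := by rintro rfl; simpa using hev a
    have hdegu : u.natDegree < f.natDegree := by
      have h2 : (f * u).natDegree ≤ 2 * (f.natDegree - 1) := by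
        rw [hfu, natDegree_neg]
        exact natDegree_add_le_of_degree_le (by simp) (natDegree_le_of_mem_weightedSumSq hs)
      rw [natDegree_mul hf0 hu0] at h2
      omega
    obtain ⟨c, -, -, h3⟩ := hmin hdegu (by
      have := mul_pos_of_neg_of_neg (hev a) (hev b)
      by_contra! hcon
      have := mul_nonpos_of_nonpos_of_nonneg hf.le hcon
      linarith)
    simpa [h3] using hev c
  obtain ⟨P, hTP, hP⟩ := hT.exists_isPrimeCone h1
  refine ⟨P, hP, ⟨hTP ⟨0, zero_mem _, 1, by ring⟩, hTP ⟨0, zero_mem _, -1, by ring⟩⟩, ?_⟩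
  intro p hp
  simpa using hTP (hsqmem hp 1)

end Polynomial

/-- The nonnegative cone of an ordered subfield of `F`. -/
structure IsOrderedSubCone {F : Type*} [Field F] (P : Set F) : Prop where
  zero_mem : 0 ∈ P
  one_mem : 1 ∈ P
  add_mem : ∀ {a b}, a ∈ P → b ∈ P → a + b ∈ P
  mul_mem : ∀ {a b}, a ∈ P → b ∈ P → a * b ∈ P
  eq_zero : ∀ {a}, a ∈ P → -a ∈ P → a = 0
  sub_mem_or : ∀ {a b}, a ∈ P → b ∈ P → a - b ∈ P ∨ b - a ∈ P

theorem IsPrimeCone.isOrderedSubCone_image {A F : Type*} [CommRing A] [Field F] {P : Set A}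
    (hP : IsPrimeCone P) (φ : A →+* F) (hφ : RingHom.ker φ = hP.support) :
    IsOrderedSubCone (φ '' P) where
  zero_mem := ⟨0, hP.zero_mem, map_zero φ⟩
  one_mem := ⟨1, hP.one_mem, map_one φ⟩
  add_mem := by
    rintro _ _ ⟨a, ha, rfl⟩ ⟨b, hb, rfl⟩
    exact ⟨a + b, hP.add_mem ha hb, map_add φ a b⟩
  mul_mem := by
    rintro _ _ ⟨a, ha, rfl⟩ ⟨b, hb, rfl⟩
    exact ⟨a * b, hP.mul_mem ha hb, map_mul φ a b⟩
  eq_zero := by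
    rintro _ ⟨a, ha, rfl⟩ ⟨b, hb, hab⟩
    have h : a + b ∈ hP.support := by
      rw [← hφ, RingHom.mem_ker, map_add, hab, add_neg_cancel]
    rw [← RingHom.mem_ker, hφ]
    refine ⟨ha, ?_⟩
    have := hP.add_mem h.2 hb
    rwa [neg_add, neg_add_cancel_right] at this
  sub_mem_or := by
    rintro _ _ ⟨a, ha, rfl⟩ ⟨b, hb, rfl⟩
    rcases hP.mem_or_neg_mem (a - b) with h | h
    · exact .inl ⟨_, h, map_sub φ a b⟩
    · exact .inr ⟨_, h, by simp⟩

namespace IsOrderedSubCone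

variable {F : Type*} [Field F] {P : Set F}

theorem exists_le_maximal (hP : IsOrderedSubCone P) :
    ∃ Q, P ⊆ Q ∧ Maximal (fun Q : Set F => IsOrderedSubCone Q) Q := by
  apply zorn_subset_nonempty {Q : Set F | IsOrderedSubCone Q}
  · intro c hc hchain hne
    have hdir {a b} (ha : a ∈ ⋃₀ c) (hb : b ∈ ⋃₀ c) : ∃ s ∈ c, a ∈ s ∧ b ∈ s := by
      obtain ⟨s, hs, ha⟩ := ha
      obtain ⟨t, ht, hb⟩ := hb
      rcases hchain.total hs ht with h | h
      · exact ⟨t, ht, h ha, hb⟩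
      · exact ⟨s, hs, ha, h hb⟩
    obtain ⟨s₀, hs₀⟩ := hne
    refine ⟨⋃₀ c, ⟨⟨s₀, hs₀, (hc hs₀).zero_mem⟩, ⟨s₀, hs₀, (hc hs₀).one_mem⟩, ?_, ?_, ?_, ?_⟩,
      fun s hs => Set.subset_sUnion_of_mem hs⟩
    · intro a b ha hb
      obtain ⟨s, hs, ha, hb⟩ := hdir ha hb
      exact ⟨s, hs, (hc hs).add_mem ha hb⟩
    · intro a b ha hb
      obtain ⟨s, hs, ha, hb⟩ := hdir ha hb
      exact ⟨s, hs, (hc hs).mul_mem ha hb⟩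
    · intro a ha hb
      obtain ⟨s, hs, ha, hb⟩ := hdir ha hb
      exact (hc hs).eq_zero ha hb
    · intro a b ha hb
      obtain ⟨s, hs, ha, hb⟩ := hdir ha hb
      exact ((hc hs).sub_mem_or ha hb).imp (fun h => ⟨s, hs, h⟩) fun h => ⟨s, hs, h⟩
  · exact hP

theorem inv_mem_of_maximal (hP : Maximal (fun Q : Set F => IsOrderedSubCone Q) P) {x : F}
    (hx : x ∈ P) : x⁻¹ ∈ P := by
  have H := hP.1
  rcases eq_or_ne x 0 with rfl | hx0
  · simpa using hx
  refine hP.2 (y := {x | ∃ s ∈ P, s ≠ 0 ∧ s * x ∈ P}) ⟨?_, ?_, ?_, ?_, ?_, ?_⟩ ?_ ?_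
  · exact ⟨1, H.one_mem, one_ne_zero, by simpa using H.zero_mem⟩
  · exact ⟨1, H.one_mem, one_ne_zero, by simpa using H.one_mem⟩
  · rintro a b ⟨s, hs, hs0, ha⟩ ⟨t, ht, ht0, hb⟩
    refine ⟨s * t, H.mul_mem hs ht, mul_ne_zero hs0 ht0, ?_⟩
    convert H.add_mem (H.mul_mem ht ha) (H.mul_mem hs hb) using 1
    ring
  · rintro a b ⟨s, hs, hs0, ha⟩ ⟨t, ht, ht0, hb⟩
    refine ⟨s * t, H.mul_mem hs ht, mul_ne_zero hs0 ht0, ?_⟩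
    convert H.mul_mem ha hb using 1
    ring
  · rintro a ⟨s, hs, hs0, ha⟩ ⟨t, ht, ht0, hb⟩
    have h := H.eq_zero (H.mul_mem ht ha) (by convert H.mul_mem hs hb using 1; ring)
    simpa [hs0, ht0] using h
  · rintro a b ⟨s, hs, hs0, ha⟩ ⟨t, ht, ht0, hb⟩
    refine (H.sub_mem_or (H.mul_mem ht ha) (H.mul_mem hs hb)).imp (fun h => ?_) fun h => ?_ <;>
    · refine ⟨s * t, H.mul_mem hs ht, mul_ne_zero hs0 ht0, ?_⟩
      convert h using 1
      ring
  · exact fun a ha => ⟨1, H.one_mem, one_ne_zero, by simpa using ha⟩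
  · exact ⟨x, hx, hx0, by simpa [hx0] using H.one_mem⟩

/-- The subfield carrying the order whose nonnegative cone is `P`. -/
def subfield (hP : IsOrderedSubCone P) (hinv : ∀ x ∈ P, x⁻¹ ∈ P) : Subfield F where
  carrier := {x | x ∈ P ∨ -x ∈ P}
  zero_mem' := .inl hP.zero_mem
  one_mem' := .inl hP.one_mem
  neg_mem' := by
    rintro x (h | h)
    · exact .inr (by simpa using h)
    · exact .inl h
  add_mem' := by
    rintro x y (hx | hx) (hy | hy)
    · exact .inl (hP.add_mem hx hy)
    · have := hP.sub_mem_or hx hy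
      rwa [sub_neg_eq_add, show -y - x = -(x + y) by ring] at this
    · have := hP.sub_mem_or hy hx
      rwa [sub_neg_eq_add, add_comm y, show -x - y = -(x + y) by ring] at this
    · right
      simpa [add_comm] using hP.add_mem hx hy
  mul_mem' := by
    rintro x y (hx | hx) (hy | hy)
    · exact .inl (hP.mul_mem hx hy)
    · exact .inr (by simpa using hP.mul_mem hx hy)
    · exact .inr (by simpa using hP.mul_mem hx hy)
    · exact .inl (by simpa using hP.mul_mem hx hy)
  inv_mem' := by
    rintro x (h | h)
    · exact .inl (hinv x h)
    · exact .inr (by simpa [inv_neg] using hinv _ h)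

/-- `P` as a cone of the subfield it orders. -/
def cone (hP : IsOrderedSubCone P) (hinv : ∀ x ∈ P, x⁻¹ ∈ P) : RingCone (hP.subfield hinv) where
  carrier := {x | (x : F) ∈ P}
  zero_mem' := hP.zero_mem
  one_mem' := hP.one_mem
  add_mem' ha hb := hP.add_mem ha hb
  mul_mem' ha hb := hP.mul_mem ha hb
  eq_zero_of_mem_of_neg_mem' ha hb := Subtype.ext (hP.eq_zero ha hb)

theorem exists_linearOrder (hP : IsOrderedSubCone P) (hinv : ∀ x ∈ P, x⁻¹ ∈ P) :
    ∃ (_ : LinearOrder (hP.subfield hinv)), IsStrictOrderedRing (hP.subfield hinv) ∧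
      ∀ x : hP.subfield hinv, 0 ≤ x ↔ (x : F) ∈ P := by
  classical
  have : HasMemOrNegMem (hP.cone hinv) := ⟨fun a => a.2⟩
  let ord := LinearOrder.mkOfAddGroupCone (hP.cone hinv)
  have : IsOrderedRing (hP.subfield hinv) := IsOrderedRing.mkOfCone (hP.cone hinv)
  refine ⟨ord, IsOrderedRing.toIsStrictOrderedRing _, fun x => ?_⟩
  change x - 0 ∈ hP.cone hinv ↔ _
  rw [sub_zero]
  exact Iff.rfl

end IsOrderedSubCone

namespace Polynomial

/-- Every prime cone is induced by a homomorphism to an ordered field with the intermediate value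
property for polynomials. -/
theorem exists_hasPolyIVT_of_isPrimeCone.{u} {A : Type u} [CommRing A] {P : Set A} (hP : IsPrimeCone P) :
    ∃ (R : Type u) (_ : Field R) (_ : LinearOrder R) (_ : IsStrictOrderedRing R) (φ : A →+* R),
      HasPolyIVT R ∧ ∀ a ∈ P, 0 ≤ φ a := by
  have := hP.isPrime_support
  let Ω := AlgebraicClosure (FractionRing (A ⧸ hP.support))
  let ψ : A →+* Ω := (algebraMap (A ⧸ hP.support) Ω).comp (Ideal.Quotient.mk hP.support)
  have hψ : RingHom.ker ψ = hP.support := by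
    have hinj : Function.Injective (algebraMap (A ⧸ hP.support) Ω) := by
      rw [IsScalarTower.algebraMap_eq _ (FractionRing (A ⧸ hP.support)) Ω]
      exact (FaithfulSMul.algebraMap_injective (FractionRing (A ⧸ hP.support)) Ω).comp (IsFractionRing.injective _ _)
    ext a
    rw [RingHom.mem_ker, RingHom.comp_apply, map_eq_zero_iff _ hinj, Ideal.Quotient.eq_zero_iff_mem]
  obtain ⟨Q, hPQ, hQ⟩ := (hP.isOrderedSubCone_image ψ hψ).exists_le_maximal
  have hinv : ∀ x ∈ Q, x⁻¹ ∈ Q := fun x hx => IsOrderedSubCone.inv_mem_of_maximal hQ hx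
  obtain ⟨ord, hord, hnonneg⟩ := hQ.1.exists_linearOrder hinv
  have hmem (a : A) : ψ a ∈ hQ.1.subfield hinv := by
    rcases hP.mem_or_neg_mem a with h | h
    · exact .inl (hPQ ⟨a, h, rfl⟩)
    · exact .inr (hPQ ⟨-a, h, map_neg ψ a⟩)
  refine ⟨hQ.1.subfield hinv, inferInstance, ord, hord, ψ.codRestrict _ hmem, ?_, fun a ha =>
    (hnonneg _).2 (hPQ ⟨a, ha, rfl⟩)⟩
  by_contra hcon
  obtain ⟨f, hirr, hroot, S, hS, hfS, hpos⟩ := exists_isPrimeCone_of_not_hasPolyIVT hcon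
  obtain ⟨α, hα⟩ := IsAlgClosed.exists_eval₂_eq_zero (hQ.1.subfield hinv).subtype f
    (degree_pos_of_irreducible hirr).ne'
  have hker : RingHom.ker (eval₂RingHom (hQ.1.subfield hinv).subtype α) = hS.support := by
    ext g
    rw [RingHom.mem_ker, coe_eval₂RingHom]
    by_cases hfg : f ∣ g
    · refine ⟨fun _ => Ideal.mem_of_dvd _ hfg hfS, fun _ => ?_⟩
      obtain ⟨k, rfl⟩ := hfg
      rw [eval₂_mul, hα, zero_mul]
    · obtain ⟨u, v, huv⟩ := (hirr.coprime_iff_not_dvd).2 hfg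
      refine ⟨fun h => ?_, fun h => ?_⟩
      · have := congrArg (eval₂ (hQ.1.subfield hinv).subtype α) huv
        simp [eval₂_add, eval₂_mul, h, hα] at this
      · refine absurd ?_ hS.isPrime_support.ne_top
        rw [Ideal.eq_top_iff_one, ← huv]
        exact add_mem (Ideal.mul_mem_left _ _ hfS) (Ideal.mul_mem_left _ _ h)
  have hle : eval₂RingHom (hQ.1.subfield hinv).subtype α '' S ⊆ Q := by
    refine hQ.2 (hS.isOrderedSubCone_image _ hker) fun x hx => ?_
    exact ⟨C ⟨x, .inl hx⟩, hpos _ ((hnonneg _).2 hx), by simp⟩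
  have hαL : α ∈ hQ.1.subfield hinv := by
    rcases hS.mem_or_neg_mem X with h | h
    · exact .inl (hle ⟨X, h, by simp⟩)
    · exact .inr (hle ⟨-X, h, by simp⟩)
  refine hroot ⟨α, hαL⟩ (Subtype.ext ?_)
  rw [eval₂_eq_eval_map, ← show (hQ.1.subfield hinv).subtype ⟨α, hαL⟩ = α from rfl,
    eval_map_apply] at hα
  exact hα

end Polynomial

namespace Polynomial

section OrderedField

variable {R : Type*} [Field R] [LinearOrder R] [IsStrictOrderedRing R]

theorem exists_forall_ge_eval_pos {f : R[X]} (hf : 0 < f.leadingCoeff) :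
    ∃ B, ∀ x, B ≤ x → 0 < f.eval x := by
  suffices ∃ B, ∃ ε > 0, ∀ x, B ≤ x → ε ≤ f.eval x by
    obtain ⟨B, ε, hε, h⟩ := this
    exact ⟨B, fun x hx => hε.trans_le (h x hx)⟩
  induction hn : f.natDegree generalizing f with
  | zero =>
    rw [eq_C_of_natDegree_eq_zero hn] at hf ⊢
    rw [leadingCoeff_C] at hf
    exact ⟨0, _, hf, fun x _ => by simp⟩
  | succ n ih =>
    have hdeg : f.divX.natDegree = n := by rw [natDegree_divX_eq_natDegree_tsub_one, hn]; rfl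
    obtain ⟨B, ε, hε, h⟩ := ih (f := f.divX)
      (by rwa [leadingCoeff, hdeg, coeff_divX, ← hn, ← leadingCoeff]) hdeg
    refine ⟨max (max B 0) ((1 + |f.coeff 0|) / ε), 1, one_pos, fun x hx => ?_⟩
    have h1 := h x ((le_max_left _ _).trans ((le_max_left _ _).trans hx))
    have h0 : 0 ≤ x := (le_max_right _ _).trans ((le_max_left _ _).trans hx)
    have h2 := (div_le_iff₀ hε).1 ((le_max_right _ _).trans hx)
    rw [← divX_mul_X_add f]
    simp only [eval_add, eval_mul, eval_X, eval_C]
    nlinarith [neg_abs_le (f.coeff 0), mul_le_mul_of_nonneg_left h1 h0]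

theorem exists_forall_ge_sign_eval (f : R[X]) :
    ∃ B, ∀ x, B ≤ x → SignType.sign (f.eval x) = SignType.sign f.leadingCoeff := by
  rcases lt_trichotomy f.leadingCoeff 0 with h | h | h
  · obtain ⟨B, hB⟩ := exists_forall_ge_eval_pos (f := -f) (by rwa [leadingCoeff_neg, neg_pos])
    refine ⟨B, fun x hx => ?_⟩
    have := hB x hx
    rw [eval_neg, neg_pos] at this
    rw [sign_neg h, sign_neg this]
  · rw [leadingCoeff_eq_zero] at h
    simp [h]
  · obtain ⟨B, hB⟩ := exists_forall_ge_eval_pos h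
    exact ⟨B, fun x hx => by rw [sign_pos h, sign_pos (hB x hx)]⟩

theorem exists_forall_le_sign_eval (f : R[X]) :
    ∃ B, ∀ x, x ≤ B →
      SignType.sign (f.eval x) = SignType.sign ((-1) ^ f.natDegree * f.leadingCoeff) := by
  obtain ⟨B, hB⟩ := exists_forall_ge_sign_eval (f.comp (-X))
  refine ⟨-B, fun x hx => ?_⟩
  have := hB (-x) (by linarith)
  rw [comp_neg_X_leadingCoeff_eq] at this
  simpa using this

end OrderedField

section IVT

variable {R : Type*} [Field R] [LinearOrder R] [IsStrictOrderedRing R]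

theorem _root_.HasPolyIVT.sign_eval_eq (hR : HasPolyIVT R) {f : R[X]} {a b : R} (hab : a ≤ b)
    (h : ∀ c, a ≤ c → c ≤ b → f.eval c ≠ 0) :
    SignType.sign (f.eval a) = SignType.sign (f.eval b) := by
  rcases hab.eq_or_lt with rfl | hab
  · rfl
  have key : ¬ f.eval a * f.eval b < 0 := fun hneg => by
    obtain ⟨c, h1, h2, h3⟩ := hR f a b hab hneg
    exact h c h1.le h2.le h3
  have ha := h a le_rfl hab.le
  have hb := h b hab.le le_rfl
  rcases lt_or_gt_of_ne ha with ha | ha <;> rcases lt_or_gt_of_ne hb with hb | hb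
  · rw [sign_neg ha, sign_neg hb]
  · exact absurd (mul_neg_of_neg_of_pos ha hb) key
  · exact absurd (mul_neg_of_pos_of_neg ha hb) key
  · rw [sign_pos ha, sign_pos hb]

/-- **Rolle's theorem** for polynomials over an ordered field with the intermediate value
property. -/
theorem _root_.HasPolyIVT.exists_derivative_eval_eq_zero (hR : HasPolyIVT R) {f : R[X]} {a b : R} (hab : a < b)
    (ha : f.eval a = 0) (hb : f.eval b = 0) :
    ∃ c, a < c ∧ c < b ∧ f.derivative.eval c = 0 := by
  classical
  rcases eq_or_ne f 0 with rfl | hf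
  · obtain ⟨c, h1, h2⟩ := exists_between hab
    exact ⟨c, h1, h2, by simp⟩
  wlog hcons : ∀ c, a < c → c < b → f.eval c ≠ 0 generalizing b
  · obtain ⟨b', hb', hmin⟩ := (f.roots.toFinset.filter (a < ·)).exists_minimal
      ⟨b, by simpa [hf, hb] using hab⟩
    simp only [mem_filter, Multiset.mem_toFinset, mem_roots hf, IsRoot.def] at hb' hmin
    have hle : b' ≤ b := by
      by_contra! hlt
      exact absurd (hmin ⟨hb, hab⟩ hlt.le) (not_le.2 hlt)
    obtain ⟨c, h1, h2, h3⟩ := this hb'.2 hb'.1 fun c h1 h2 h3 =>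
      absurd (hmin ⟨h3, h1⟩ h2.le) (not_le.2 h2)
    exact ⟨c, h1, h2.trans_le hle, h3⟩
  obtain ⟨g, hg, hga⟩ := exists_eq_pow_rootMultiplicity_mul_and_not_dvd f hf a
  have hg0 : g ≠ 0 := by rintro rfl; exact hga (dvd_zero _)
  obtain ⟨k, hk, hkb⟩ := exists_eq_pow_rootMultiplicity_mul_and_not_dvd g hg0 b
  have hm : f.rootMultiplicity a ≠ 0 := (rootMultiplicity_pos hf).2 ha |>.ne'
  have hn : g.rootMultiplicity b ≠ 0 := by
    refine ((rootMultiplicity_pos hg0).2 ?_).ne'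
    rw [hg] at hb
    simpa [sub_ne_zero.2 hab.ne'] using hb
  obtain ⟨m, hm⟩ := Nat.exists_eq_succ_of_ne_zero hm
  obtain ⟨n, hn⟩ := Nat.exists_eq_succ_of_ne_zero hn
  rw [hm] at hg
  rw [hn] at hk
  have hka : k.eval a ≠ 0 := fun h => hga (by
    rw [dvd_iff_isRoot, IsRoot.def, hk]; simp [h])
  have hkb : k.eval b ≠ 0 := fun h => hkb (by rwa [dvd_iff_isRoot, IsRoot.def])
  have hsign := hR.sign_eval_eq (f := k) hab.le fun c h1 h2 h3 => by
    rcases h1.eq_or_lt with rfl | h1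
    · exact hka h3
    rcases h2.eq_or_lt with rfl | h2
    · exact hkb h3
    exact hcons c h1 h2 (by rw [hg, hk]; simp [h3])
  obtain ⟨c, h1, h2, h3⟩ := hR (C ((m : R) + 1) * (X - C b) * k + C ((n : R) + 1) * (X - C a) * k +
    (X - C a) * (X - C b) * derivative k) a b hab (by
      have h1 : 0 < k.eval a * k.eval b := by
        rw [← sign_eq_one_iff, sign_mul, ← hsign, ← sign_mul]
        exact sign_pos (mul_self_pos.2 hka)
      have h2 : 0 < (b - a) * (b - a) := mul_self_pos.2 (sub_ne_zero.2 hab.ne')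
      have h3 : 0 < ((m : R) + 1) * ((n : R) + 1) := by positivity
      have := mul_pos h3 (mul_pos h2 h1)
      simp only [eval_add, eval_mul, eval_sub, eval_X, eval_C, sub_self]
      nlinarith)
  refine ⟨c, h1, h2, ?_⟩
  rw [hg, hk]
  simp only [derivative_mul, derivative_pow_succ, derivative_sub, derivative_X, derivative_C,
    eval_add, eval_mul, eval_sub, eval_pow, eval_X, eval_C, eval_one, eval_zero] at h3 ⊢
  simp only [Nat.succ_eq_add_one, pow_succ]
  linear_combination (c - a) ^ m * (c - b) ^ n * h3

theorem _root_.HasPolyIVT.eval_mul_eval_neg_of_unique_root (hR : HasPolyIVT R) {f : R[X]} {a t b : R} (hat : a < t)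
    (htb : t < b) (ht : f.eval t = 0) (ht' : f.derivative.eval t ≠ 0)
    (h : ∀ c, a ≤ c → c ≤ b → f.eval c = 0 → c = t) : f.eval a * f.eval b < 0 := by
  obtain ⟨g, rfl⟩ := dvd_iff_isRoot.2 ht
  have hgt : g.eval t ≠ 0 := by simpa [derivative_mul] using ht'
  have hg (c) (h1 : a ≤ c) (h2 : c ≤ b) : g.eval c ≠ 0 := fun h0 => by
    have := h c h1 h2 (by simp [h0])
    exact hgt (this ▸ h0)
  have hsign := hR.sign_eval_eq (hat.trans htb).le hg
  have h1 : 0 < g.eval a * g.eval b := by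
    rw [← sign_eq_one_iff, sign_mul, ← hsign, ← sign_mul]
    exact sign_pos (mul_self_pos.2 (hg a le_rfl (hat.trans htb).le))
  have h2 : 0 < (t - a) * (b - t) := mul_pos (by linarith) (by linarith)
  have := mul_pos h2 h1
  simp only [eval_mul, eval_sub, eval_X, eval_C]
  nlinarith

end IVT

end Polynomial

theorem hasPolyIVT_real : HasPolyIVT ℝ := by
  intro f a b hab hf
  have hcont : ContinuousOn (fun x => f.eval x) (Set.Icc a b) := f.continuous.continuousOn
  rcases mul_neg_iff.1 hf with ⟨h1, h2⟩ | ⟨h1, h2⟩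
  · obtain ⟨c, hc, h⟩ := intermediate_value_Ioo' hab.le hcont ⟨h2, h1⟩
    exact ⟨c, hc.1, hc.2, h⟩
  · obtain ⟨c, hc, h⟩ := intermediate_value_Ioo hab.le hcont ⟨h1, h2⟩
    exact ⟨c, hc.1, hc.2, h⟩

namespace Polynomial

section PseudoRemainder

variable {D : Type*} [CommRing D]

theorem exists_pseudoRemainder (g : D[X]) (hg : g.natDegree ≠ 0) (f : D[X]) :
    ∃ (N : ℕ) (q r : D[X]), r.natDegree < g.natDegree ∧
      C g.leadingCoeff ^ N * f = q * g + r := by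
  induction hn : f.natDegree using Nat.strong_induction_on generalizing f with
  | _ n ih =>
    by_cases hlt : f.natDegree < g.natDegree
    · exact ⟨0, 0, f, hlt, by simp⟩
    push Not at hlt
    let f' := C g.leadingCoeff * f - C f.leadingCoeff * X ^ (f.natDegree - g.natDegree) * g
    have hf' : f'.natDegree < f.natDegree := by
      have hle : f'.natDegree ≤ f.natDegree := by
        refine (natDegree_sub_le_of_le (n := f.natDegree) (natDegree_C_mul_le _ f) ?_).trans
          (max_self _).le
        refine natDegree_mul_le.trans ?_
        have := natDegree_C_mul_X_pow_le f.leadingCoeff (f.natDegree - g.natDegree)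
        omega
      refine lt_of_le_of_ne hle fun heq => ?_
      have hc : f'.coeff f.natDegree = 0 := by
        have : f.natDegree = g.natDegree + (f.natDegree - g.natDegree) := by omega
        have h2 : (C f.leadingCoeff * X ^ (f.natDegree - g.natDegree) * g).coeff f.natDegree =
            f.leadingCoeff * g.leadingCoeff := by
          rw [mul_assoc, coeff_C_mul, X_pow_mul]
          nth_rw 2 [this]
          rw [coeff_mul_X_pow, ← leadingCoeff]
        simp only [f', coeff_sub, coeff_C_mul, h2]
        rw [← leadingCoeff]; ring
      rw [← heq, ← leadingCoeff, leadingCoeff_eq_zero] at hc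
      rw [hc, natDegree_zero] at heq
      omega
    obtain ⟨N, q, r, hr, h⟩ := ih _ (hn ▸ hf') f' rfl
    refine ⟨N + 1, q + C g.leadingCoeff ^ N * C f.leadingCoeff * X ^ (f.natDegree - g.natDegree),
      r, hr, ?_⟩
    linear_combination h

/-- A finite set of polynomials closed under the operations producing polynomials of smaller degree
which are used to determine sign changes. -/
structure IsSignClosed (d : ℕ) (S : Finset D[X]) : Prop where
  derivative_mem : ∀ g ∈ S, d < g.natDegree → derivative g ∈ S
  eraseLead_mem : ∀ g ∈ S, d < g.natDegree → g.eraseLead ∈ S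
  rem_mem : ∀ g ∈ S, d < g.natDegree → ∀ f ∈ S, g.natDegree ≤ f.natDegree →
    ∃ (N : ℕ) (q : D[X]), ∃ r ∈ S, r.natDegree < g.natDegree ∧
      C g.leadingCoeff ^ N * f = q * g + r

theorem IsSignClosed.exists_superset {d : ℕ} {S : Finset D[X]} (hS : IsSignClosed d S) :
    ∃ S', S ⊆ S' ∧ IsSignClosed 0 S' := by
  classical
  induction d generalizing S with
  | zero => exact ⟨S, subset_rfl, hS⟩
  | succ d ih =>
    have hrem (g : D[X]) (f : D[X]) : ∃ r : D[X], g.natDegree ≠ 0 → r.natDegree < g.natDegree ∧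
        ∃ (N : ℕ) (q : D[X]), C g.leadingCoeff ^ N * f = q * g + r := by
      by_cases hg : g.natDegree = 0
      · exact ⟨0, fun h => absurd hg h⟩
      · obtain ⟨N, q, r, hr, h⟩ := exists_pseudoRemainder g hg f
        exact ⟨r, fun _ => ⟨hr, N, q, h⟩⟩
    choose rem hrem using hrem
    let G := S.filter (·.natDegree = d + 1)
    let T := G.image derivative ∪ G.image eraseLead ∪ G.biUnion fun g => S.image (rem g)
    have hT {f : D[X]} (hf : f ∈ T) : f.natDegree ≤ d := by
      simp only [T, mem_union, mem_image, mem_biUnion, G, mem_filter] at hf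
      rcases hf with (⟨g, ⟨-, hg⟩, rfl⟩ | ⟨g, ⟨-, hg⟩, rfl⟩) | ⟨g, ⟨-, hg⟩, f, -, rfl⟩
      · have := natDegree_derivative_lt (p := g) (by omega)
        omega
      · have := eraseLead_natDegree_le g
        omega
      · have := (hrem g f (by omega)).1
        omega
    have hmem {f : D[X]} (hf : f ∈ S ∪ T) (hd : d < f.natDegree) : f ∈ S := by
      rcases mem_union.1 hf with h | h
      · exact h
      · exact absurd (hT h) (by omega)
    obtain ⟨S', hS', hcl⟩ := ih (S := S ∪ T) (by
      constructor
      · intro g hg hd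
        have hgS := hmem hg hd
        rcases eq_or_ne g.natDegree (d + 1) with h | h
        · refine mem_union_right _ (mem_union_left _ (mem_union_left _ (mem_image_of_mem _ ?_)))
          exact mem_filter.2 ⟨hgS, h⟩
        · exact mem_union_left _ (hS.derivative_mem g hgS (by omega))
      · intro g hg hd
        have hgS := hmem hg hd
        rcases eq_or_ne g.natDegree (d + 1) with h | h
        · refine mem_union_right _ (mem_union_left _ (mem_union_right _ (mem_image_of_mem _ ?_)))
          exact mem_filter.2 ⟨hgS, h⟩
        · exact mem_union_left _ (hS.eraseLead_mem g hgS (by omega))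
      · intro g hg hd f hf hfg
        have hgS := hmem hg hd
        have hfS := hmem hf (hd.trans_le hfg)
        rcases eq_or_ne g.natDegree (d + 1) with h | h
        · obtain ⟨hr, N, q, hq⟩ := hrem g f (by omega)
          refine ⟨N, q, rem g f, ?_, hr, hq⟩
          refine mem_union_right _ (mem_union_right _ (mem_biUnion.2 ⟨g, ?_, ?_⟩))
          · exact mem_filter.2 ⟨hgS, h⟩
          · exact mem_image_of_mem _ hfS
        · obtain ⟨N, q, r, hr, h'⟩ := hS.rem_mem g hgS (by omega) f hfS hfg
          exact ⟨N, q, r, mem_union_left _ hr, h'⟩)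
    exact ⟨S', subset_union_left.trans hS', hcl⟩

theorem exists_isSignClosed (S : Finset D[X]) : ∃ S', S ⊆ S' ∧ IsSignClosed 0 S' := by
  have h {g : D[X]} (hg : g ∈ S) : ¬ S.sup natDegree < g.natDegree :=
    not_lt.2 (le_sup (f := natDegree) hg)
  exact IsSignClosed.exists_superset (d := S.sup natDegree)
    ⟨fun g hg hd => absurd hd (h hg), fun g hg hd => absurd hd (h hg),
      fun g hg hd => absurd hd (h hg)⟩

theorem IsSignClosed.of_insert [DecidableEq D[X]] {S : Finset D[X]} {a : D[X]}
    (hmax : ∀ x ∈ S, x.natDegree ≤ a.natDegree) (h : IsSignClosed 0 (insert a S)) :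
    IsSignClosed 0 S where
  derivative_mem g hg hd := (mem_insert.1 (h.derivative_mem g (mem_insert_of_mem hg) hd)).resolve_left
    fun heq => by
      have := natDegree_derivative_lt (p := g) hd.ne'
      have := hmax g hg
      rw [← heq] at this
      omega
  eraseLead_mem g hg hd := (mem_insert.1 (h.eraseLead_mem g (mem_insert_of_mem hg) hd)).resolve_left
    fun heq => by
      have := eraseLead_natDegree_le g
      have := hmax g hg
      rw [← heq] at this
      omega
  rem_mem g hg hd f hf hfg := by
    obtain ⟨N, q, r, hr, hrg, hq⟩ := h.rem_mem g (mem_insert_of_mem hg) hd f (mem_insert_of_mem hf)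
      hfg
    refine ⟨N, q, r, (mem_insert.1 hr).resolve_left fun heq => ?_, hrg, hq⟩
    have := hmax g hg
    rw [← heq] at this
    omega

end PseudoRemainder

end Polynomial

section SameCut

variable {α β : Type*} [LinearOrder α] [LinearOrder β]

/-- Two points occupy the same position relative to a set of pairs of points. -/
def SameCut (Z : Set (α × β)) (t : α) (u : β) : Prop :=
  ∀ z ∈ Z, (z.1 < t ↔ z.2 < u) ∧ (t < z.1 ↔ u < z.2)

namespace SameCut

variable {Z : Set (α × β)}

theorem swap {t : α} {u : β} (h : SameCut Z t u) : SameCut (Prod.swap ⁻¹' Z) u t :=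
  fun z hz => ⟨(h z.swap hz).1.symm, (h z.swap hz).2.symm⟩

theorem mono {Y : Set (α × β)} (hYZ : Y ⊆ Z) {t : α} {u : β} (h : SameCut Z t u) :
    SameCut Y t u :=
  fun z hz => h z (hYZ hz)

theorem snd_eq {z : α × β} (hz : z ∈ Z) {u : β} (h : SameCut Z z.1 u) : z.2 = u :=
  le_antisymm (not_lt.1 fun hlt => lt_irrefl _ ((h z hz).2.2 hlt))
    (not_lt.1 fun hlt => lt_irrefl _ ((h z hz).1.2 hlt))

theorem exists_snd [DenselyOrdered β] [NoMinOrder β] [NoMaxOrder β] [Nonempty β] (hZ : Z.Finite)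
    (hcut : ∀ z ∈ Z, SameCut Z z.1 z.2) (t : α) : ∃ u, SameCut Z t u := by
  classical
  by_cases ht : ∃ z ∈ Z, z.1 = t
  · obtain ⟨z, hz, rfl⟩ := ht
    exact ⟨z.2, hcut z hz⟩
  push Not at ht
  obtain ⟨u, h1, h2⟩ := Order.exists_between_finsets
    ((hZ.toFinset.filter (·.1 < t)).image Prod.snd) ((hZ.toFinset.filter (t < ·.1)).image Prod.snd)
    (by
      simp only [mem_image, mem_filter, Set.Finite.mem_toFinset]
      rintro _ ⟨z, ⟨hz, hzt⟩, rfl⟩ _ ⟨w, ⟨hw, hwt⟩, rfl⟩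
      exact (hcut w hw z hz).1.1 (hzt.trans hwt))
  have hlt (z) (hz : z ∈ Z) (h : z.1 < t) : z.2 < u :=
    h1 _ (mem_image_of_mem _ (mem_filter.2 ⟨hZ.mem_toFinset.2 hz, h⟩))
  have hgt (z) (hz : z ∈ Z) (h : t < z.1) : u < z.2 :=
    h2 _ (mem_image_of_mem _ (mem_filter.2 ⟨hZ.mem_toFinset.2 hz, h⟩))
  refine ⟨u, fun z hz => ?_⟩
  rcases lt_or_gt_of_ne (ht z hz) with h | h
  · have := hlt z hz h
    exact ⟨iff_of_true h this, iff_of_false h.not_gt this.not_gt⟩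
  · have := hgt z hz h
    exact ⟨iff_of_false h.not_gt this.not_gt, iff_of_true h this⟩

theorem exists_lower [NoMinOrder α] [NoMinOrder β] (hZ : Z.Finite)
    (hcut : ∀ z ∈ Z, SameCut Z z.1 z.2) {Q : α → β → Prop} (hQ : ∀ z ∈ Z, Q z.1 z.2)
    (hlo : ∃ x₀ y₀, ∀ x ≤ x₀, ∀ y ≤ y₀, Q x y) {t : α} {u : β} (h : SameCut Z t u) :
    ∃ a b, a < t ∧ b < u ∧ Q a b ∧ ∀ z ∈ Z, z.1 < t → z.1 ≤ a ∧ z.2 ≤ b := by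
  rcases Set.eq_empty_or_nonempty {z ∈ Z | z.1 < t} with hemp | hne
  · obtain ⟨x₀, y₀, hlo⟩ := hlo
    obtain ⟨x, hx⟩ := exists_lt t
    obtain ⟨y, hy⟩ := exists_lt u
    refine ⟨min x₀ x, min y₀ y, (min_le_right _ _).trans_lt hx, (min_le_right _ _).trans_lt hy,
      hlo _ (min_le_left _ _) _ (min_le_left _ _), fun z hz hzt => ?_⟩
    exact absurd (show z ∈ {z ∈ Z | z.1 < t} from ⟨hz, hzt⟩) (by simp [hemp])
  · obtain ⟨w, ⟨hw, hwt⟩, hmax⟩ := Set.exists_max_image _ Prod.fst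
      (hZ.subset (Set.sep_subset Z fun z => z.1 < t)) hne
    refine ⟨w.1, w.2, hwt, (h w hw).1.1 hwt, hQ w hw, fun z hz hzt => ?_⟩
    have hle := hmax z ⟨hz, hzt⟩
    exact ⟨hle, not_lt.1 fun hlt => hle.not_gt ((hcut z hz w hw).1.2 hlt)⟩

theorem exists_upper [NoMaxOrder α] [NoMaxOrder β] (hZ : Z.Finite)
    (hcut : ∀ z ∈ Z, SameCut Z z.1 z.2) {Q : α → β → Prop} (hQ : ∀ z ∈ Z, Q z.1 z.2)
    (hhi : ∃ x₀ y₀, ∀ x, x₀ ≤ x → ∀ y, y₀ ≤ y → Q x y) {t : α} {u : β} (h : SameCut Z t u) :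
    ∃ a b, t < a ∧ u < b ∧ Q a b ∧ ∀ z ∈ Z, t < z.1 → a ≤ z.1 ∧ b ≤ z.2 :=
  exists_lower (α := αᵒᵈ) (β := βᵒᵈ) (Z := Z) hZ
    (fun z hz w hw => ⟨(hcut z hz w hw).2, (hcut z hz w hw).1⟩) (Q := Q) hQ hhi
    (fun z hz => ⟨(h z hz).2, (h z hz).1⟩)

end SameCut

end SameCut

namespace Polynomial

variable {R R' : Type*} [Field R] [LinearOrder R] [Field R'] [LinearOrder R']

/-- A finite matching `Z` of points of two ordered fields, containing the critical points of `F` and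
`G`, at which `F` and `G` have the same signs. -/
structure IsCriticalMatching (F : R[X]) (G : R'[X]) (Z : Set (R × R')) : Prop where
  finite : Z.Finite
  sameCut : ∀ z ∈ Z, SameCut Z z.1 z.2
  natDegree_eq : F.natDegree = G.natDegree
  natDegree_ne_zero : F.natDegree ≠ 0
  sign_leadingCoeff : SignType.sign F.leadingCoeff = SignType.sign G.leadingCoeff
  sign_eval : ∀ z ∈ Z, SignType.sign (F.eval z.1) = SignType.sign (G.eval z.2)
  critical_left : ∀ t, F.derivative.eval t = 0 → ∃ z ∈ Z, z.1 = t
  critical_right : ∀ t, G.derivative.eval t = 0 → ∃ z ∈ Z, z.2 = t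

namespace IsCriticalMatching

variable {F : R[X]} {G : R'[X]} {Z : Set (R × R')}

theorem swap (h : IsCriticalMatching F G Z) : IsCriticalMatching G F (Prod.swap ⁻¹' Z) where
  finite := h.finite.preimage Prod.swap_injective.injOn
  sameCut z hz := (h.sameCut z.swap hz).swap
  natDegree_eq := h.natDegree_eq.symm
  natDegree_ne_zero := h.natDegree_eq ▸ h.natDegree_ne_zero
  sign_leadingCoeff := h.sign_leadingCoeff.symm
  sign_eval z hz := (h.sign_eval z.swap hz).symm
  critical_left t ht := by
    obtain ⟨z, hz, rfl⟩ := h.critical_right t ht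
    exact ⟨z.swap, by simpa using hz, rfl⟩
  critical_right t ht := by
    obtain ⟨z, hz, rfl⟩ := h.critical_left t ht
    exact ⟨z.swap, by simpa using hz, rfl⟩

variable [IsStrictOrderedRing R]

/-- The pairs of roots of `F` and `G` in the same position relative to `Z`. -/
def rootPairs (F : R[X]) (G : R'[X]) (Z : Set (R × R')) : Set (R × R') :=
  {z | SameCut Z z.1 z.2 ∧ F.eval z.1 = 0 ∧ G.eval z.2 = 0}

theorem lt_of_mem_rootPairs (h : IsCriticalMatching F G Z) (hR : HasPolyIVT R) {z w : R × R'}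
    (hz : z ∈ rootPairs F G Z) (hw : w ∈ rootPairs F G Z) (hlt : z.1 < w.1) : z.2 < w.2 := by
  obtain ⟨c, h1, h2, h3⟩ := hR.exists_derivative_eval_eq_zero hlt hz.2.1 hw.2.1
  obtain ⟨v, hv, rfl⟩ := h.critical_left c h3
  exact ((hz.1 v hv).2.1 h1).trans ((hw.1 v hv).1.1 h2)

variable [IsStrictOrderedRing R']

/-- Any two points in the same position lie in intervals which contain no matched points and at
whose endpoints `F` and `G` have the same signs. -/
theorem exists_bracket (h : IsCriticalMatching F G Z) {t : R} {u : R'} (htu : SameCut Z t u)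
    (ht : ∀ z ∈ Z, z.1 ≠ t) :
    ∃ a b a' b', a < t ∧ t < b ∧ a' < u ∧ u < b' ∧
      SignType.sign (F.eval a) = SignType.sign (G.eval a') ∧
      SignType.sign (F.eval b) = SignType.sign (G.eval b') ∧
      ∀ z ∈ Z, (z.1 ≤ a ∧ z.2 ≤ a') ∨ (b ≤ z.1 ∧ b' ≤ z.2) := by
  obtain ⟨a, a', ha, ha', hQ, hlow⟩ := SameCut.exists_lower h.finite h.sameCut
    (Q := fun x y => SignType.sign (F.eval x) = SignType.sign (G.eval y)) h.sign_eval (by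
      obtain ⟨x₀, h₁⟩ := exists_forall_le_sign_eval F
      obtain ⟨y₀, h₂⟩ := exists_forall_le_sign_eval G
      refine ⟨x₀, y₀, fun x hx y hy => ?_⟩
      rw [h₁ x hx, h₂ y hy, sign_mul, sign_mul, h.sign_leadingCoeff, h.natDegree_eq, sign_pow,
        sign_pow, sign_neg neg_one_lt_zero, sign_neg neg_one_lt_zero]) htu
  obtain ⟨b, b', hb, hb', hQ', hupp⟩ := SameCut.exists_upper h.finite h.sameCut
    (Q := fun x y => SignType.sign (F.eval x) = SignType.sign (G.eval y)) h.sign_eval (by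
      obtain ⟨x₀, h₁⟩ := exists_forall_ge_sign_eval F
      obtain ⟨y₀, h₂⟩ := exists_forall_ge_sign_eval G
      exact ⟨x₀, y₀, fun x hx y hy => by rw [h₁ x hx, h₂ y hy, h.sign_leadingCoeff]⟩) htu
  refine ⟨a, b, a', b', ha, hb, ha', hb', hQ, hQ', fun z hz => ?_⟩
  rcases lt_or_gt_of_ne (ht z hz) with h' | h'
  · exact .inl (hlow z hz h')
  · exact .inr (hupp z hz h')

theorem exists_root (h : IsCriticalMatching F G Z) (hR : HasPolyIVT R) (hR' : HasPolyIVT R')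
    {t : R} (ht : F.eval t = 0) : ∃ u, SameCut Z t u ∧ G.eval u = 0 := by
  by_cases htZ : ∃ z ∈ Z, z.1 = t
  · obtain ⟨z, hz, rfl⟩ := htZ
    refine ⟨z.2, h.sameCut z hz, ?_⟩
    have := h.sign_eval z hz
    rwa [ht, sign_zero, eq_comm, sign_eq_zero_iff] at this
  push Not at htZ
  obtain ⟨u₀, hu₀⟩ := SameCut.exists_snd h.finite h.sameCut t
  obtain ⟨a, b, a', b', hat, htb, hau, hub, hsa, hsb, hZ⟩ := h.exists_bracket hu₀ htZ
  have hcrit (c) (h1 : a < c) (h2 : c < b) : F.derivative.eval c ≠ 0 := fun h0 => by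
    obtain ⟨z, hz, rfl⟩ := h.critical_left c h0
    rcases hZ z hz with h' | h'
    · exact h1.not_ge h'.1
    · exact h2.not_ge h'.1
  have hneg : F.eval a * F.eval b < 0 := by
    refine hR.eval_mul_eval_neg_of_unique_root hat htb ht (hcrit t hat htb) fun c h1 h2 h3 => ?_
    by_contra hne
    rcases lt_or_gt_of_ne hne with hlt | hlt
    · obtain ⟨d, h4, h5, h6⟩ := hR.exists_derivative_eval_eq_zero hlt h3 ht
      exact hcrit d (h1.trans_lt h4) (h5.trans htb) h6
    · obtain ⟨d, h4, h5, h6⟩ := hR.exists_derivative_eval_eq_zero hlt ht h3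
      exact hcrit d (hat.trans h4) (h5.trans_le h2) h6
  rw [← sign_eq_neg_one_iff, sign_mul, hsa, hsb, ← sign_mul, sign_eq_neg_one_iff] at hneg
  obtain ⟨u, h1, h2, h3⟩ := hR' G a' b' (hau.trans hub) hneg
  refine ⟨u, fun z hz => ?_, h3⟩
  rcases hZ z hz with h' | h'
  · have h4 := h'.1.trans_lt hat
    have h5 := h'.2.trans_lt h1
    exact ⟨iff_of_true h4 h5, iff_of_false h4.not_gt h5.not_gt⟩
  · have h4 := htb.trans_le h'.1
    have h5 := h2.trans_le h'.2
    exact ⟨iff_of_false h4.not_gt h5.not_gt, iff_of_true h4 h5⟩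

theorem union_rootPairs (h : IsCriticalMatching F G Z) (hR : HasPolyIVT R)
    (hR' : HasPolyIVT R') : IsCriticalMatching F G (Z ∪ rootPairs F G Z) where
  finite := by
    have hF : F ≠ 0 := by rintro rfl; exact h.natDegree_ne_zero rfl
    have hG : G ≠ 0 := by rintro rfl; exact h.natDegree_ne_zero h.natDegree_eq
    refine h.finite.union ((F.rootSet_finite R).prod (G.rootSet_finite R') |>.subset fun z hz => ?_)
    simpa [mem_rootSet, hF, hG] using hz.2
  sameCut := by
    have hlt {z w : R × R'} (hz : z ∈ rootPairs F G Z) (hw : w ∈ rootPairs F G Z) :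
        z.1 < w.1 ↔ z.2 < w.2 :=
      ⟨h.lt_of_mem_rootPairs hR hz hw, h.swap.lt_of_mem_rootPairs hR'
        (z := z.swap) (w := w.swap) ⟨hz.1.swap, hz.2.2, hz.2.1⟩ ⟨hw.1.swap, hw.2.2, hw.2.1⟩⟩
    rintro z (hz | hz) w (hw | hw)
    · exact h.sameCut z hz w hw
    · exact ⟨(hw.1 z hz).2, (hw.1 z hz).1⟩
    · exact hz.1 w hw
    · exact ⟨hlt hw hz, hlt hz hw⟩
  natDegree_eq := h.natDegree_eq
  natDegree_ne_zero := h.natDegree_ne_zero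
  sign_leadingCoeff := h.sign_leadingCoeff
  sign_eval := by
    rintro z (hz | hz)
    · exact h.sign_eval z hz
    · rw [hz.2.1, hz.2.2, sign_zero, sign_zero]
  critical_left t ht := (h.critical_left t ht).imp fun z hz => ⟨.inl hz.1, hz.2⟩
  critical_right t ht := (h.critical_right t ht).imp fun z hz => ⟨.inl hz.1, hz.2⟩

theorem sign_eval_eq_of_sameCut (h : IsCriticalMatching F G Z) (hR : HasPolyIVT R)
    (hR' : HasPolyIVT R') {t : R} {u : R'} (htu : SameCut (Z ∪ rootPairs F G Z) t u) :
    SignType.sign (F.eval t) = SignType.sign (G.eval u) := by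
  have H := h.union_rootPairs hR hR'
  by_cases htZ : ∃ z ∈ Z ∪ rootPairs F G Z, z.1 = t
  · obtain ⟨z, hz, rfl⟩ := htZ
    rw [← SameCut.snd_eq hz htu]
    exact H.sign_eval z hz
  push Not at htZ
  obtain ⟨a, b, a', b', hat, htb, hau, hub, hsa, hsb, hZ⟩ := H.exists_bracket htu htZ
  have hroot (c) (h1 : a < c) (h2 : c < b) : F.eval c ≠ 0 := fun h0 => by
    obtain ⟨v, hv, hv0⟩ := h.exists_root hR hR' h0
    rcases hZ (c, v) (.inr ⟨hv, h0, hv0⟩) with h' | h'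
    · exact h1.not_ge h'.1
    · exact h2.not_ge h'.1
  have hroot' (c) (h1 : a' < c) (h2 : c < b') : G.eval c ≠ 0 := fun h0 => by
    obtain ⟨v, hv, hv0⟩ := h.swap.exists_root hR' hR h0
    rcases hZ (v, c) (.inr ⟨hv.swap, hv0, h0⟩) with h' | h'
    · exact h1.not_ge h'.2
    · exact h2.not_ge h'.2
  by_cases ha : F.eval a = 0
  · by_cases hb : F.eval b = 0
    · obtain ⟨c, h1, h2, h3⟩ := hR.exists_derivative_eval_eq_zero (hat.trans htb) ha hb
      obtain ⟨z, hz, rfl⟩ := h.critical_left c h3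
      rcases hZ z (.inl hz) with h' | h'
      · exact absurd h'.1 h1.not_ge
      · exact absurd h'.1 h2.not_ge
    · have hb' : G.eval b' ≠ 0 := by
        rwa [ne_eq, ← sign_eq_zero_iff, ← hsb, sign_eq_zero_iff]
      rw [hR.sign_eval_eq htb.le, hsb, hR'.sign_eval_eq hub.le]
      · intro c h1 h2
        rcases h2.eq_or_lt with rfl | h2
        exacts [hb', hroot' c (hau.trans_le h1) h2]
      · intro c h1 h2
        rcases h2.eq_or_lt with rfl | h2
        exacts [hb, hroot c (hat.trans_le h1) h2]
  · have ha' : G.eval a' ≠ 0 := by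
      rwa [ne_eq, ← sign_eq_zero_iff, ← hsa, sign_eq_zero_iff]
    rw [← hR.sign_eval_eq hat.le, hsa, hR'.sign_eval_eq hau.le]
    · intro c h1 h2
      rcases h1.eq_or_lt with rfl | h1
      exacts [ha', hroot' c h1 (h2.trans_lt hub)]
    · intro c h1 h2
      rcases h1.eq_or_lt with rfl | h1
      exacts [ha, hroot c h1 (h2.trans_lt htb)]

end IsCriticalMatching

end Polynomial

namespace Polynomial

theorem map_eq_map_eraseLead {A B : Type*} [CommRing A] [CommRing B] (ψ : A →+* B) {f : A[X]}
    (hf : ψ f.leadingCoeff = 0) :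
    f.map ψ = f.eraseLead.map ψ := by
  conv_lhs => rw [← f.eraseLead_add_C_mul_X_pow, Polynomial.map_add, Polynomial.map_mul, map_C, hf]
  simp

section SignDiagram

variable {D R R' : Type*} [CommRing D] [Field R] [LinearOrder R] [Field R'] [LinearOrder R']

/-- A finite matching `Z` between the roots of the images of the polynomials of `S` over two ordered
fields, which determines the signs of all these images. -/
structure IsSignDiagram (φ : D →+* R) (φ' : D →+* R') (S : Finset D[X]) (Z : Set (R × R')) :
    Prop where
  finite : Z.Finite
  sameCut : ∀ z ∈ Z, SameCut Z z.1 z.2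
  exists_isRoot : ∀ z ∈ Z, ∃ g ∈ S, φ g.leadingCoeff ≠ 0 ∧ g.natDegree ≠ 0 ∧
    (g.map φ).eval z.1 = 0 ∧ (g.map φ').eval z.2 = 0
  root_left : ∀ g ∈ S, g.map φ ≠ 0 → ∀ t, (g.map φ).eval t = 0 → ∃ z ∈ Z, z.1 = t
  root_right : ∀ g ∈ S, g.map φ' ≠ 0 → ∀ u, (g.map φ').eval u = 0 → ∃ z ∈ Z, z.2 = u
  sign_eq : ∀ t u, SameCut Z t u → ∀ g ∈ S,
    SignType.sign ((g.map φ).eval t) = SignType.sign ((g.map φ').eval u)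

variable {φ : D →+* R} {φ' : D →+* R'}

theorem IsSignDiagram.insert_of_trivial [DecidableEq D[X]] {S : Finset D[X]} {Z : Set (R × R')}
    (h : IsSignDiagram φ φ' S Z) {f : D[X]}
    (hl : f.map φ ≠ 0 → ∀ t, (f.map φ).eval t = 0 → ∃ z ∈ Z, z.1 = t)
    (hr : f.map φ' ≠ 0 → ∀ u, (f.map φ').eval u = 0 → ∃ z ∈ Z, z.2 = u)
    (hs : ∀ t u, SameCut Z t u →
      SignType.sign ((f.map φ).eval t) = SignType.sign ((f.map φ').eval u)) :
    IsSignDiagram φ φ' (insert f S) Z where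
  finite := h.finite
  sameCut := h.sameCut
  exists_isRoot z hz := by
    obtain ⟨g, hg, h'⟩ := h.exists_isRoot z hz
    exact ⟨g, mem_insert_of_mem hg, h'⟩
  root_left := (forall_mem_insert _ _ _).2 ⟨hl, h.root_left⟩
  root_right := (forall_mem_insert _ _ _).2 ⟨hr, h.root_right⟩
  sign_eq t u htu := (forall_mem_insert _ _ _).2 ⟨hs t u htu, h.sign_eq t u htu⟩

variable [IsStrictOrderedRing R] [IsStrictOrderedRing R']

theorem IsSignDiagram.exists_insert [DecidableEq D[X]] (hR : HasPolyIVT R) (hR' : HasPolyIVT R')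
    {S : Finset D[X]} {Z : Set (R × R')} (h : IsSignDiagram φ φ' S Z) {f : D[X]} (hf : f ∉ S)
    (hmax : ∀ g ∈ S, g.natDegree ≤ f.natDegree) (hcl : IsSignClosed 0 (insert f S))
    (hlc : SignType.sign (φ f.leadingCoeff) = SignType.sign (φ' f.leadingCoeff))
    (hlcS : ∀ g ∈ S, SignType.sign (φ g.leadingCoeff) = SignType.sign (φ' g.leadingCoeff)) :
    ∃ Y, IsSignDiagram φ φ' (insert f S) Y := by
  have hmem {g : D[X]} (hg : g ∈ insert f S) (hlt : g.natDegree < f.natDegree) : g ∈ S :=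
    (mem_insert.1 hg).resolve_left (by rintro rfl; exact lt_irrefl _ hlt)
  by_cases hd : f.natDegree = 0
  · refine ⟨Z, ?_⟩
    rw [leadingCoeff, hd] at hlc
    rw [eq_C_of_natDegree_eq_zero hd] at hf ⊢
    apply h.insert_of_trivial <;> simp +contextual [hlc]
  by_cases h0 : φ f.leadingCoeff = 0
  · have h0' : φ' f.leadingCoeff = 0 := by simpa [h0, eq_comm (a := (0 : SignType))] using hlc
    have hm := hmem (hcl.eraseLead_mem f (mem_insert_self _ _) (Nat.pos_of_ne_zero hd))
      (by have := eraseLead_natDegree_le f; omega)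
    refine ⟨Z, h.insert_of_trivial ?_ ?_ ?_⟩
    · rw [map_eq_map_eraseLead φ h0]; exact h.root_left _ hm
    · rw [map_eq_map_eraseLead φ' h0']; exact h.root_right _ hm
    · rw [map_eq_map_eraseLead φ h0, map_eq_map_eraseLead φ' h0']
      exact fun t u htu => h.sign_eq t u htu _ hm
  have h0' : φ' f.leadingCoeff ≠ 0 := by
    intro h'; exact h0 (by simpa [h'] using hlc)
  have hder := hmem (hcl.derivative_mem f (mem_insert_self _ _) (Nat.pos_of_ne_zero hd))
    (natDegree_derivative_lt hd)
  have hdF : (f.map φ).natDegree = f.natDegree := natDegree_map_of_leadingCoeff_ne_zero φ h0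
  have hdG : (f.map φ').natDegree = f.natDegree := natDegree_map_of_leadingCoeff_ne_zero φ' h0'
  have hcrit : IsCriticalMatching (f.map φ) (f.map φ') Z :=
    { finite := h.finite
      sameCut := h.sameCut
      natDegree_eq := hdF.trans hdG.symm
      natDegree_ne_zero := hdF ▸ hd
      sign_leadingCoeff := by
        rwa [leadingCoeff_map_of_leadingCoeff_ne_zero φ h0,
          leadingCoeff_map_of_leadingCoeff_ne_zero φ' h0']
      sign_eval := by
        intro z hz
        obtain ⟨g, hg, hg0, hgd, hz1, hz2⟩ := h.exists_isRoot z hz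
        obtain ⟨N, q, r, hr, hrg, heq⟩ := hcl.rem_mem g (mem_insert_of_mem hg)
          (Nat.pos_of_ne_zero hgd) f (mem_insert_self _ _) (hmax g hg)
        have hrS := hmem hr (hrg.trans_le (hmax g hg))
        have e1 := congrArg (fun x => SignType.sign ((x.map φ).eval z.1)) heq
        have e2 := congrArg (fun x => SignType.sign ((x.map φ').eval z.2)) heq
        simp only [Polynomial.map_mul, Polynomial.map_add, Polynomial.map_pow, map_C, eval_mul,
          eval_add, eval_pow, eval_C, hz1, hz2, mul_zero, zero_add, sign_mul, sign_pow] at e1 e2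
        have := h.sign_eq _ _ (h.sameCut z hz) r hrS
        rw [← e1, ← e2, ← hlcS g hg] at this
        refine mul_left_cancel₀ (pow_ne_zero _ ?_) this
        rwa [Ne, sign_eq_zero_iff]
      critical_left := by
        rw [derivative_map]
        refine h.root_left _ hder ?_
        rw [← derivative_map]
        exact fun h' => hd (hdF ▸ derivative_eq_zero.1 h')
      critical_right := by
        rw [derivative_map]
        refine h.root_right _ hder ?_
        rw [← derivative_map]
        exact fun h' => hd (hdG ▸ derivative_eq_zero.1 h') }
  have hY := hcrit.union_rootPairs hR hR'
  refine ⟨Z ∪ IsCriticalMatching.rootPairs (f.map φ) (f.map φ') Z, hY.finite, hY.sameCut, ?_, ?_, ?_, ?_⟩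
  · rintro z (hz | hz)
    · obtain ⟨g, hg, h'⟩ := h.exists_isRoot z hz
      exact ⟨g, mem_insert_of_mem hg, h'⟩
    · exact ⟨f, mem_insert_self _ _, h0, hd, hz.2⟩
  · refine (forall_mem_insert _ _ _).2 ⟨fun _ t ht => ?_, fun g hg hg0 t ht => ?_⟩
    · obtain ⟨u, hu, hu0⟩ := hcrit.exists_root hR hR' ht
      exact ⟨(t, u), .inr ⟨hu, ht, hu0⟩, rfl⟩
    · obtain ⟨z, hz, h'⟩ := h.root_left g hg hg0 t ht
      exact ⟨z, .inl hz, h'⟩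
  · refine (forall_mem_insert _ _ _).2 ⟨fun _ t ht => ?_, fun g hg hg0 t ht => ?_⟩
    · obtain ⟨u, hu, hu0⟩ := hcrit.swap.exists_root hR' hR ht
      exact ⟨(u, t), .inr ⟨hu.swap, hu0, ht⟩, rfl⟩
    · obtain ⟨z, hz, h'⟩ := h.root_right g hg hg0 t ht
      exact ⟨z, .inl hz, h'⟩
  · refine fun t u htu => (forall_mem_insert _ _ _).2 ⟨hcrit.sign_eval_eq_of_sameCut hR hR' htu, ?_⟩
    exact h.sign_eq t u (htu.mono Set.subset_union_left)

theorem IsSignClosed.exists_isSignDiagram (hR : HasPolyIVT R) (hR' : HasPolyIVT R')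
    {S : Finset D[X]} (hS : IsSignClosed 0 S)
    (hlc : ∀ g ∈ S, SignType.sign (φ g.leadingCoeff) = SignType.sign (φ' g.leadingCoeff)) :
    ∃ Z, IsSignDiagram φ φ' S Z := by
  classical
  revert hS hlc
  refine Finset.induction_on_max_value natDegree S (fun _ _ => ⟨∅, by constructor <;> simp⟩)
    fun f S hf hmax ih hS hlc => ?_
  rw [forall_mem_insert] at hlc
  obtain ⟨Z, hZ⟩ := ih (hS.of_insert hmax) hlc.2
  exact hZ.exists_insert hR hR' hf hmax hS hlc.1 hlc.2

/-- Transfer of sign conditions in one variable between two real closed fields: it is governed by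
finitely many signs of coefficients. -/
theorem exists_finset_forall_exists_sign_eq (S : Finset D[X]) :
    ∃ S' : Finset D, ∀ {R R' : Type*} [Field R] [LinearOrder R] [IsStrictOrderedRing R]
      [Field R'] [LinearOrder R'] [IsStrictOrderedRing R'], HasPolyIVT R → HasPolyIVT R' →
      ∀ (φ : D →+* R) (φ' : D →+* R'),
      (∀ c ∈ S', SignType.sign (φ c) = SignType.sign (φ' c)) → ∀ t, ∃ u, ∀ g ∈ S,
        SignType.sign ((g.map φ).eval t) = SignType.sign ((g.map φ').eval u) := by
  classical
  obtain ⟨S₁, hS₁, hcl⟩ := exists_isSignClosed S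
  refine ⟨S₁.image leadingCoeff, fun hR hR' φ φ' h t => ?_⟩
  obtain ⟨Z, hZ⟩ := hcl.exists_isSignDiagram hR hR' (φ := φ) (φ' := φ')
    fun g hg => h _ (mem_image_of_mem _ hg)
  obtain ⟨u, hu⟩ := SameCut.exists_snd hZ.finite hZ.sameCut t
  exact ⟨u, fun g hg => hZ.sign_eq t u hu g (hS₁ hg)⟩

end SignDiagram

end Polynomial

namespace MvPolynomial

theorem sign_ringHom_real {R : Type*} [Field R] [LinearOrder R] [IsStrictOrderedRing R]
    (φ : ℝ →+* R) (r : ℝ) : SignType.sign (φ r) = SignType.sign r := by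
  have hpos {r : ℝ} (hr : 0 < r) : 0 < φ r := by
    rw [← Real.mul_self_sqrt hr.le, map_mul]
    exact mul_self_pos.2 ((map_ne_zero φ).2 (Real.sqrt_pos.2 hr).ne')
  rcases lt_trichotomy r 0 with h | rfl | h
  · have := hpos (neg_pos.2 h)
    rw [map_neg, neg_pos] at this
    rw [sign_neg h, sign_neg this]
  · simp
  · rw [sign_pos h, sign_pos (hpos h)]

/-- The **Artin–Lang theorem** over the reals: finitely many sign conditions satisfied at a point
with coordinates in a real closed field are satisfied at a real point. -/
theorem exists_forall_sign_eval_eq {R : Type*} [Field R] [LinearOrder R] [IsStrictOrderedRing R]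
    (hR : HasPolyIVT R) {n : ℕ} (S : Finset (MvPolynomial (Fin n) ℝ))
    (ψ : MvPolynomial (Fin n) ℝ →+* R) :
    ∃ x : Fin n → ℝ, ∀ f ∈ S, SignType.sign (ψ f) = SignType.sign (eval x f) := by
  classical
  induction n with
  | zero =>
    refine ⟨0, fun f _ => ?_⟩
    rw [eq_C_of_isEmpty f, eval_C]
    exact sign_ringHom_real (ψ.comp C) _
  | succ n ih =>
    obtain ⟨S', hS'⟩ := Polynomial.exists_finset_forall_exists_sign_eq
      (S.image (finSuccEquiv ℝ n))
    obtain ⟨x, hx⟩ := ih S' (ψ.comp (rename Fin.succ : _ →ₐ[ℝ] MvPolynomial (Fin (n + 1)) ℝ))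
    obtain ⟨u, hu⟩ := hS' hR hasPolyIVT_real _ (eval x) hx (ψ (X 0))
    refine ⟨Fin.cons u x, fun f hf => ?_⟩
    rw [eval_eq_eval_mv_eval', ← hu _ (mem_image_of_mem _ hf)]
    congr 1
    refine RingHom.congr_fun (g := (Polynomial.evalRingHom (ψ (X 0))).comp
      ((Polynomial.mapRingHom _).comp (RingHomClass.toRingHom (finSuccEquiv ℝ n)))) ?_ f
    refine ringHom_ext (fun r => ?_) fun i => ?_
    · simp [finSuccEquiv_apply]
    · cases i using Fin.cases <;> simp [finSuccEquiv_apply]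

theorem isPreordering_isSumSq {A : Type*} [CommRing A] : IsPreordering {a : A | IsSumSq a} where
  add_mem := IsSumSq.add
  mul_mem := IsSumSq.mul
  sq_mem a := by rw [sq]; exact .mul_self a

/-- A case of the **Positivstellensatz**: a certificate that `g` is negative where `q` is
nonnegative. -/
theorem exists_neg_one_eq_of_forall_eval_neg {n : ℕ} {q g : MvPolynomial (Fin n) ℝ}
    (h : ∀ x, 0 ≤ eval x q → eval x g < 0) :
    ∃ s₀ s₁ t₀ t₁ : MvPolynomial (Fin n) ℝ, IsSumSq s₀ ∧ IsSumSq s₁ ∧ IsSumSq t₀ ∧ IsSumSq t₁ ∧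
      -1 = (s₀ + s₁ * q) + (t₀ + t₁ * q) * g := by
  classical
  have hT := (isPreordering_isSumSq (A := MvPolynomial (Fin n) ℝ)).adjoin q
  by_contra! hne
  obtain ⟨P, hTP, hP⟩ := (hT.adjoin g).exists_isPrimeCone (by
    rintro ⟨_, ⟨s₀, h₀, s₁, h₁, rfl⟩, _, ⟨t₀, h₂, t₁, h₃, rfl⟩, heq⟩
    exact hne s₀ s₁ t₀ t₁ h₀ h₁ h₂ h₃ heq)
  obtain ⟨R, _, _, _, φ, hR, hφ⟩ := Polynomial.exists_hasPolyIVT_of_isPrimeCone hP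
  obtain ⟨x, hx⟩ := exists_forall_sign_eval_eq hR {q, g} φ
  have hnonneg {f} (hf : f ∈ ({q, g} : Finset (MvPolynomial (Fin n) ℝ))) (hfP : f ∈ P) :
      0 ≤ eval x f := by
    rw [← sign_nonneg_iff, ← hx f hf, sign_nonneg_iff]
    exact hφ f hfP
  refine (h x (hnonneg (by simp) ?_)).not_ge (hnonneg (by simp) ?_)
  · exact hTP ⟨q, ⟨0, .zero, 1, isPreordering_isSumSq.one_mem, by ring⟩, 0, hT.zero_mem, by ring⟩
  · exact hTP ⟨0, hT.zero_mem, 1, hT.one_mem, by ring⟩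

end MvPolynomial

namespace IsQuadModule

theorem of_isPreordering {A : Type*} [CommRing A] {T : Set A} (hT : IsPreordering T) : IsQuadModule T where
  one_mem := hT.one_mem
  add_mem := hT.add_mem
  sq_mul_mem a _ hq := hT.mul_mem (hT.sq_mem a) hq

section Bounded

variable {A : Type*} [CommRing A] [Algebra ℝ A] {Q : Set A}

/-- The elements bounded, up to sign, by a constant modulo `Q`. -/
def boundedElements (Q : Set A) : Set A :=
  {a | ∃ N : ℝ, algebraMap ℝ A N - a ∈ Q ∧ algebraMap ℝ A N + a ∈ Q}

theorem algebraMap_mem_boundedElements (hQ : IsQuadModule Q) (r : ℝ) :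
    algebraMap ℝ A r ∈ boundedElements Q := by
  refine ⟨|r|, ?_, ?_⟩
  · rw [← map_sub]; exact hQ.algebraMap_mem (sub_nonneg.2 (le_abs_self r))
  · rw [← map_add]; exact hQ.algebraMap_mem (by linarith [neg_abs_le r])

theorem neg_mem_boundedElements {a : A} (ha : a ∈ boundedElements Q) : -a ∈ boundedElements Q := by
  obtain ⟨N, h₁, h₂⟩ := ha
  exact ⟨N, by simpa using h₂, by simpa [sub_eq_add_neg] using h₁⟩

theorem add_mem_boundedElements (hQ : IsQuadModule Q) {a b : A} (ha : a ∈ boundedElements Q)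
    (hb : b ∈ boundedElements Q) : a + b ∈ boundedElements Q := by
  obtain ⟨N, h₁, h₂⟩ := ha
  obtain ⟨N', h₃, h₄⟩ := hb
  refine ⟨N + N', ?_, ?_⟩ <;> rw [map_add]
  · convert hQ.add_mem h₁ h₃ using 1; ring
  · convert hQ.add_mem h₂ h₄ using 1; ring

theorem sq_mem_boundedElements (hQ : IsQuadModule Q) {a : A} (ha : a ∈ boundedElements Q) :
    a ^ 2 ∈ boundedElements Q := by
  obtain ⟨N, h₁, h₂⟩ := ha
  have hpos : 0 < 2 * (|N| + 1) := by positivity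
  have hc := hQ.algebraMap_mem (A := A) (r := |N| + 1 - N) (by linarith [le_abs_self N])
  have h := hQ.mul_mem_of_add_eq hpos (hQ.add_mem h₁ hc) (hQ.add_mem h₂ hc) (by
    simp only [map_mul, map_add, map_sub, map_ofNat]; ring)
  refine ⟨(|N| + 1) ^ 2, ?_, ?_⟩
  · convert h using 1
    simp only [map_add, map_sub, map_pow]; ring
  · exact hQ.add_mem (hQ.algebraMap_mem (by positivity)) (hQ.sq_mem a)

theorem mul_mem_boundedElements (hQ : IsQuadModule Q) {a b : A} (ha : a ∈ boundedElements Q)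
    (hb : b ∈ boundedElements Q) : a * b ∈ boundedElements Q := by
  obtain ⟨N, h₁, h₂⟩ := hQ.add_mem_boundedElements
    (hQ.sq_mem_boundedElements (hQ.add_mem_boundedElements ha hb))
    (neg_mem_boundedElements (hQ.sq_mem_boundedElements
      (hQ.add_mem_boundedElements ha (neg_mem_boundedElements hb))))
  have h4 : (4 : A) * algebraMap ℝ A (N / 4) = algebraMap ℝ A N := by
    rw [show (4 : A) = algebraMap ℝ A 4 from (map_ofNat _ 4).symm, ← map_mul]; congr 1; ring
  refine ⟨N / 4, hQ.mem_of_algebraMap_mul_mem (r := 4) (by norm_num) ?_,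
    hQ.mem_of_algebraMap_mul_mem (r := 4) (by norm_num) ?_⟩
  · convert h₁ using 1
    rw [map_ofNat]; linear_combination h4
  · convert h₂ using 1
    rw [map_ofNat]; linear_combination h4

end Bounded

variable {n : ℕ} {Q : Set (MvPolynomial (Fin n) ℝ)}

/-- A quadratic module is Archimedean as soon as it bounds the squared norm. -/
theorem exists_algebraMap_sub_mem (hQ : IsQuadModule Q) {N : ℝ}
    (hN : C N - ∑ i, X i ^ 2 ∈ Q) (f : MvPolynomial (Fin n) ℝ) :
    ∃ r : ℝ, algebraMap ℝ _ r - f ∈ Q := by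
  suffices h : f ∈ boundedElements Q from h.imp fun _ h => h.1
  have hX (i : Fin n) : X i ∈ boundedElements Q := by
    have h : C N - X i ^ 2 ∈ Q := by
      have hs : ∑ j ∈ univ.erase i, (X j : MvPolynomial (Fin n) ℝ) ^ 2 ∈ Q :=
        Finset.sum_induction _ (· ∈ Q) (fun _ _ => hQ.add_mem) hQ.zero_mem
          fun j _ => hQ.sq_mem _
      convert hQ.add_mem hN hs using 1
      rw [← add_sum_erase _ _ (mem_univ i)]; ring
    have h4 : (C 4⁻¹ : MvPolynomial (Fin n) ℝ) = C 2⁻¹ ^ 2 := by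
      rw [← map_pow]; norm_num
    have h2 : (2 : MvPolynomial (Fin n) ℝ) * C 2⁻¹ = 1 := by
      rw [← map_ofNat C 2, ← map_mul]; norm_num
    refine ⟨N + 4⁻¹, ?_, ?_⟩ <;> simp only [algebraMap_eq, map_add, h4]
    · convert hQ.add_mem h (hQ.sq_mem (X i - C 2⁻¹)) using 1
      linear_combination X i * h2
    · convert hQ.add_mem h (hQ.sq_mem (X i + C 2⁻¹)) using 1
      linear_combination -X i * h2
  induction f using MvPolynomial.induction_on with
  | C r => exact hQ.algebraMap_mem_boundedElements r
  | add p q hp hq => exact hQ.add_mem_boundedElements hp hq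
  | mul_X p i hp => exact hQ.mul_mem_boundedElements hp (hX i)

/-- **Wörmann's theorem** for one inequality: a quadratic module containing a polynomial with
compact nonnegativity set bounds the squared norm. -/
theorem exists_C_sub_sum_sq_mem (hQ : IsQuadModule Q) {q : MvPolynomial (Fin n) ℝ} (hq : q ∈ Q)
    (hc : IsCompact {x : Fin n → ℝ | 0 ≤ eval x q}) : ∃ N : ℝ, C N - ∑ i, X i ^ 2 ∈ Q := by
  obtain ⟨M, hM⟩ := (hc.image (f := fun x => ∑ i, x i ^ 2) (by fun_prop)).bddAbove
  have hlt (x : Fin n → ℝ) (hx : 0 ≤ eval x q) :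
      eval x (∑ i, X i ^ 2 - C (|M| + 1)) < 0 := by
    have := hM (Set.mem_image_of_mem _ hx)
    simp only [map_sub, map_sum, map_pow, eval_X, eval_C]
    linarith [le_abs_self M]
  have hM0 : 0 ≤ |M| + 1 := by positivity
  generalize |M| + 1 = m at hlt hM0
  obtain ⟨s₀, s₁, t₀, t₁, hs₀, hs₁, ht₀, ht₁, heq⟩ := exists_neg_one_eq_of_forall_eval_neg hlt
  have hT := (isPreordering_isSumSq (A := MvPolynomial (Fin n) ℝ)).adjoin q
  have hTm := of_isPreordering hT
  set T := {x : MvPolynomial (Fin n) ℝ | ∃ p ∈ {a | IsSumSq a}, ∃ r ∈ {a | IsSumSq a},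
    x = p + r * q}
  have hTQ : T ⊆ Q := by
    rintro _ ⟨p, hp, r, hr, rfl⟩
    exact hQ.add_mem (hQ.isSumSq_mem hp) (hQ.isSumSq_mul_mem hr hq)
  have hS : s₀ + s₁ * q ∈ T := ⟨s₀, hs₀, s₁, hs₁, rfl⟩
  have ht : t₀ + t₁ * q ∈ T := ⟨t₀, ht₀, t₁, ht₁, rfl⟩
  generalize s₀ + s₁ * q = s at heq hS
  generalize t₀ + t₁ * q = t at heq ht
  have he : ∑ i, (X i : MvPolynomial (Fin n) ℝ) ^ 2 ∈ T :=
    Finset.sum_induction _ (· ∈ T) (fun _ _ => hT.add_mem) hT.zero_mem fun j _ => hT.sq_mem _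
  obtain ⟨f, hf⟩ : ∃ f, f = C m - ∑ i, (X i : MvPolynomial (Fin n) ℝ) ^ 2 := ⟨_, rfl⟩
  generalize hE : ∑ i, (X i : MvPolynomial (Fin n) ℝ) ^ 2 = e at he heq hf hlt ⊢
  have hft : f * t = 1 + s := by rw [hf]; linear_combination heq
  have hT₀ := of_isPreordering
    ((isPreordering_isSumSq (A := MvPolynomial (Fin n) ℝ)).adjoin f)
  have hsumsq {p : MvPolynomial (Fin n) ℝ} (hp : IsSumSq p) : p ∈ T := hTm.isSumSq_mem hp
  have h1s : 1 + s ∈ T := hT.add_mem hT.one_mem hS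
  have hfs : f * (1 + s) ∈ T := by
    rw [← hft, ← mul_assoc, ← sq]
    exact hT.mul_mem (hT.sq_mem f) ht
  obtain ⟨k, p, hp, r, hr, hk⟩ := hT₀.exists_algebraMap_sub_mem (N := m)
    ⟨0, .zero, 1, isPreordering_isSumSq.one_mem, by rw [hf, hE]; ring⟩ s
  rw [algebraMap_eq] at hk
  have h₁ : (C k - s) * (1 + s) ∈ T := by
    rw [hk, add_mul, mul_assoc]
    exact hT.add_mem (hT.mul_mem (hsumsq hp) h1s) (hT.mul_mem (hsumsq hr) hfs)
  have h₂ : C (k + (k / 2) ^ 2) - s ∈ T := by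
    convert hT.add_mem h₁ (hT.sq_mem (C (k / 2) - s)) using 1
    have : (2 : MvPolynomial (Fin n) ℝ) * C (k / 2) = C k := by
      rw [← map_ofNat C 2, ← map_mul]; congr 1; ring
    rw [map_add, map_pow]
    linear_combination s * this
  refine ⟨m + m * (k + (k / 2) ^ 2), hTQ ?_⟩
  convert hT.add_mem (hT.add_mem hfs (hT.mul_mem he hS)) (hTm.algebraMap_mul_mem hM0 h₂) using 1
  rw [hf, algebraMap_eq, map_add, map_mul]
  ring

end IsQuadModule

section SumsOfSquares

variable {n : ℕ}

theorem isSumSq_of_isSOSPoly {s : MvPolynomial (Fin n) ℝ} (hs : IsSOSPoly s) : IsSumSq s := by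
  obtain ⟨t, r, rfl⟩ := hs
  exact .sum_sq _ _

theorem isSOSPoly_of_isSumSq {s : MvPolynomial (Fin n) ℝ} (hs : IsSumSq s) : IsSOSPoly s := by
  induction hs with
  | zero => exact ⟨0, ![], by simp⟩
  | sq_add a _ ih =>
    obtain ⟨t, r, rfl⟩ := ih
    exact ⟨t + 1, Fin.cons a r, by simp [Fin.sum_univ_succ, sq]⟩

variable {ι : Type*} {E I : Finset ι} {c : ι → MvPolynomial (Fin n) ℝ}

theorem isQuadModule_idealQM : IsQuadModule (idealQM E I c) where
  one_mem := ⟨0, 1, 0, isSOSPoly_of_isSumSq .one, fun _ _ => isSOSPoly_of_isSumSq .zero, by simp⟩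
  add_mem := by
    rintro _ _ ⟨h, σ₀, σ, h₀, hσ, rfl⟩ ⟨h', σ₀', σ', h₀', hσ', rfl⟩
    refine ⟨h + h', σ₀ + σ₀', σ + σ', isSOSPoly_of_isSumSq
      ((isSumSq_of_isSOSPoly h₀).add (isSumSq_of_isSOSPoly h₀')), fun j hj => isSOSPoly_of_isSumSq
      ((isSumSq_of_isSOSPoly (hσ j hj)).add (isSumSq_of_isSOSPoly (hσ' j hj))), ?_⟩
    simp only [Pi.add_apply, add_mul, sum_add_distrib]
    ring
  sq_mul_mem := by
    rintro a _ ⟨h, σ₀, σ, h₀, hσ, rfl⟩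
    have ha : IsSumSq (a ^ 2) := sq a ▸ .mul_self a
    refine ⟨fun j => a ^ 2 * h j, a ^ 2 * σ₀, fun j => a ^ 2 * σ j, isSOSPoly_of_isSumSq
      (ha.mul (isSumSq_of_isSOSPoly h₀)), fun j hj => isSOSPoly_of_isSumSq
      (ha.mul (isSumSq_of_isSOSPoly (hσ j hj))), ?_⟩
    simp only [mul_add, mul_sum, mul_assoc]

theorem mul_mem_idealQM [DecidableEq ι] (h : MvPolynomial (Fin n) ℝ) {j : ι} (hj : j ∈ E) :
    h * c j ∈ idealQM E I c :=
  ⟨Pi.single j h, 0, 0, isSOSPoly_of_isSumSq .zero, fun _ _ => isSOSPoly_of_isSumSq .zero,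
    by simp [Pi.single_apply, ite_mul, hj]⟩

theorem mem_idealQM [DecidableEq ι] {j : ι} (hj : j ∈ I) : c j ∈ idealQM E I c :=
  ⟨0, 0, Pi.single j 1, isSOSPoly_of_isSumSq .zero, fun i _ => by
    rcases eq_or_ne i j with rfl | hij
    · simpa using isSOSPoly_of_isSumSq .one
    · simpa [hij] using isSOSPoly_of_isSumSq .zero,
    by simp [Pi.single_apply, ite_mul, hj]⟩

/-- **Putinar's Positivstellensatz**. -/
theorem mem_idealQM_of_forall_eval_pos [DecidableEq ι]
    (hArch : ∃ q ∈ idealQM E I c, IsCompact {x : Fin n → ℝ | 0 ≤ eval x q})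
    {f : MvPolynomial (Fin n) ℝ}
    (hf : ∀ x, (∀ j ∈ E, eval x (c j) = 0) → (∀ j ∈ I, 0 ≤ eval x (c j)) → 0 < eval x f) :
    f ∈ idealQM E I c := by
  have hQ := isQuadModule_idealQM (E := E) (I := I) (c := c)
  obtain ⟨q, hq, hqc⟩ := hArch
  obtain ⟨N, hN⟩ := hQ.exists_C_sub_sum_sq_mem hq hqc
  refine hQ.mem_of_forall_algHom_pos (hQ.exists_algebraMap_sub_mem hN) fun χ hχ => ?_
  have heval (p : MvPolynomial (Fin n) ℝ) : χ p = eval (fun i => χ (X i)) p := by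
    rw [← coe_aeval_eq_eval]
    exact DFunLike.congr_fun (aeval_unique χ) p
  rw [heval]
  refine hf _ (fun j hj => ?_) fun j hj => ?_
  · have h₁ := hχ _ (mul_mem_idealQM 1 hj)
    have h₂ := hχ _ (mul_mem_idealQM (-1) hj)
    rw [heval] at h₁ h₂
    simp only [map_mul, map_neg, map_one] at h₁ h₂
    linarith
  · rw [← heval]
    exact hχ _ (mem_idealQM hj)

end SumsOfSquares

section Moments

variable {n : ℕ}

/-- The linear functional on polynomials with moments `y`. -/
def momentFunctional (y : (Fin n →₀ ℕ) → ℝ) : MvPolynomial (Fin n) ℝ →ₗ[ℝ] ℝ :=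
  (basisMonomials (Fin n) ℝ).constr ℝ y

theorem momentFunctional_monomial (y : (Fin n →₀ ℕ) → ℝ) (α : Fin n →₀ ℕ) (r : ℝ) :
    momentFunctional y (monomial α r) = r * y α := by
  have h := (basisMonomials (Fin n) ℝ).constr_basis ℝ y α
  rw [coe_basisMonomials] at h
  rw [← mul_one r, ← smul_eq_mul, ← smul_monomial, map_smul, momentFunctional, h, smul_eq_mul,
    smul_eq_mul, mul_one]

theorem momentFunctional_apply (y : (Fin n →₀ ℕ) → ℝ) (p : MvPolynomial (Fin n) ℝ) :
    momentFunctional y p = pairing p y := by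
  conv_lhs => rw [p.as_sum, map_sum]
  exact sum_congr rfl fun α _ => momentFunctional_monomial y α _

theorem momentFunctional_mul (y : (Fin n →₀ ℕ) → ℝ) (p q : MvPolynomial (Fin n) ℝ) :
    momentFunctional y (p * q) =
      ∑ α ∈ p.support, ∑ β ∈ q.support, p.coeff α * q.coeff β * y (α + β) := by
  conv_lhs => rw [p.as_sum, q.as_sum]
  simp only [sum_mul, mul_sum, map_sum, monomial_mul, momentFunctional_monomial]
  exact sum_comm

/-- The moments of the functional `p ↦ ⟨c p, y⟩`. -/
def shiftedMoments (c : MvPolynomial (Fin n) ℝ) (y : (Fin n →₀ ℕ) → ℝ) : (Fin n →₀ ℕ) → ℝ :=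
  fun δ => ∑ γ ∈ c.support, c.coeff γ * y (γ + δ)

theorem locEntry_eq (c : MvPolynomial (Fin n) ℝ) (y : (Fin n →₀ ℕ) → ℝ) (α β : Fin n →₀ ℕ) :
    locEntry c y α β = shiftedMoments c y (α + β) := by
  simp only [locEntry, shiftedMoments, add_assoc]

theorem momentFunctional_mul_eq_shiftedMoments (c : MvPolynomial (Fin n) ℝ)
    (y : (Fin n →₀ ℕ) → ℝ) (p : MvPolynomial (Fin n) ℝ) :
    momentFunctional y (p * c) = momentFunctional (shiftedMoments c y) p := by
  rw [momentFunctional_mul, momentFunctional_apply, pairing]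
  refine sum_congr rfl fun α _ => ?_
  rw [shiftedMoments, mul_sum]
  exact sum_congr rfl fun β _ => by rw [mul_assoc, add_comm α]

theorem eventually_momentFunctional_nonneg {σ : MvPolynomial (Fin n) ℝ} (hσ : IsSOSPoly σ) :
    ∀ᶠ k in atTop, ∀ z : (Fin n →₀ ℕ) → ℝ, momMatPSD k z → 0 ≤ momentFunctional z σ := by
  obtain ⟨t, r, rfl⟩ := hσ
  have h : ∀ᶠ k in atTop, ∀ j, (r j).totalDegree ≤ k :=
    eventually_all.2 fun j => eventually_ge_atTop _
  filter_upwards [h] with k hk z hz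
  rw [map_sum]
  refine sum_nonneg fun j _ => ?_
  rw [sq, momentFunctional_mul]
  exact hz _ (hk j)

theorem eventually_momentFunctional_mul_nonneg {σ : MvPolynomial (Fin n) ℝ} (hσ : IsSOSPoly σ)
    (c : MvPolynomial (Fin n) ℝ) : ∀ᶠ k in atTop, ∀ y : (Fin n →₀ ℕ) → ℝ, locMatPSD c k y →
      0 ≤ momentFunctional y (σ * c) := by
  filter_upwards [(tendsto_sub_atTop_nat (ceilHalf c.totalDegree)).eventually
    (eventually_momentFunctional_nonneg hσ)] with k hk y hy
  rw [momentFunctional_mul_eq_shiftedMoments]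
  refine hk _ fun q hq => ?_
  simpa only [locEntry_eq] using hy q hq

theorem eventually_momentFunctional_mul_eq_zero (h c : MvPolynomial (Fin n) ℝ) :
    ∀ᶠ k in atTop, ∀ y : (Fin n →₀ ℕ) → ℝ, locMatZero c k y →
      momentFunctional y (h * c) = 0 := by
  filter_upwards [(tendsto_sub_atTop_nat (ceilHalf c.totalDegree)).eventually_ge_atTop
    h.totalDegree] with k hk y hy
  rw [momentFunctional_mul_eq_shiftedMoments, momentFunctional_apply, pairing]
  refine sum_eq_zero fun α hα => ?_
  have hdeg := (le_totalDegree hα).trans hk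
  rw [Finsupp.sum_fintype _ _ fun _ => rfl] at hdeg
  have := hy α 0 hdeg (by simp [mdeg])
  rw [locEntry_eq, add_zero] at this
  rw [this, mul_zero]

theorem eventually_pairing_nonneg {ι : Type*} {E I : Finset ι} {c : ι → MvPolynomial (Fin n) ℝ}
    {f : MvPolynomial (Fin n) ℝ} (hf : f ∈ idealQM E I c) :
    ∀ᶠ k in atTop, ∀ y, momFeasible (c '' ↑E) (c '' ↑I) k y → 0 ≤ momentFunctional y f := by
  obtain ⟨h, σ₀, σ, h₀, hσ, rfl⟩ := hf
  filter_upwards [eventually_momentFunctional_nonneg h₀,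
    (eventually_all_finset E).2 fun j _ => eventually_momentFunctional_mul_eq_zero (h j) (c j),
    (eventually_all_finset I).2 fun j hj => eventually_momentFunctional_mul_nonneg (hσ j hj) (c j)]
    with k hk₁ hk₂ hk₃ y ⟨_, hy₁, hy₂, hy₃⟩
  simp only [map_add, map_sum]
  rw [sum_eq_zero fun j hj => hk₂ j hj y (hy₂ _ (Set.mem_image_of_mem _ hj)), zero_add]
  exact add_nonneg (hk₁ y hy₁) (sum_nonneg fun j hj =>
    hk₃ j hj y (hy₃ _ (Set.mem_image_of_mem _ hj)))

/-- The moments of the Dirac measure at `x`. -/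
def diracMoments (x : Fin n → ℝ) : (Fin n →₀ ℕ) → ℝ := fun α => ∏ i, x i ^ α i

theorem momentFunctional_diracMoments (x : Fin n → ℝ) (p : MvPolynomial (Fin n) ℝ) :
    momentFunctional (diracMoments x) p = eval x p := by
  rw [momentFunctional_apply, eval_eq']
  rfl

theorem shiftedMoments_diracMoments (c : MvPolynomial (Fin n) ℝ) (x : Fin n → ℝ)
    (δ : Fin n →₀ ℕ) : shiftedMoments c (diracMoments x) δ = eval x c * diracMoments x δ := by
  rw [eval_eq', sum_mul]
  refine sum_congr rfl fun γ _ => ?_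
  simp only [diracMoments, Finsupp.add_apply, pow_add, prod_mul_distrib, mul_assoc]

theorem momMatPSD_diracMoments (k : ℕ) (x : Fin n → ℝ) : momMatPSD k (diracMoments x) := by
  intro q _
  rw [← momentFunctional_mul, momentFunctional_diracMoments, map_mul]
  exact mul_self_nonneg _

theorem momFeasible_diracMoments {Eqs Ineqs : Set (MvPolynomial (Fin n) ℝ)} {x : Fin n → ℝ}
    (hE : ∀ c ∈ Eqs, eval x c = 0) (hI : ∀ c ∈ Ineqs, 0 ≤ eval x c) (k : ℕ) :
    momFeasible Eqs Ineqs k (diracMoments x) := by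
  refine ⟨by simp [diracMoments], momMatPSD_diracMoments k x, fun c hc α β _ _ => ?_,
    fun c hc q hq => ?_⟩
  · rw [locEntry_eq, shiftedMoments_diracMoments, hE c hc, zero_mul]
  · have := mul_nonneg (hI c hc) (momMatPSD_diracMoments q.totalDegree x q le_rfl)
    simp only [mul_sum] at this
    refine this.trans_eq (sum_congr rfl fun α _ => sum_congr rfl fun β _ => ?_)
    rw [locEntry_eq, shiftedMoments_diracMoments]
    ring

end Moments

section Objective

theorem elog_le_coe_log {s t : ℝ} (hst : s ≤ t) : elog s ≤ (Real.log t : ℝ) := by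
  unfold elog
  split_ifs with hs
  · exact_mod_cast Real.log_le_log hs hst
  · exact bot_le

theorem le_exp_div_of_mul_elog_le {a t γ : ℝ} (ha : 0 < a)
    (h : (a : EReal) * elog t ≤ (γ : ℝ)) : t ≤ Real.exp (γ / a) := by
  by_cases ht : 0 < t
  · rw [elog, if_pos ht] at h
    have h' : a * Real.log t ≤ γ := by exact_mod_cast h
    rw [← Real.log_le_iff_le_exp ht, le_div_iff₀ ha]
    linarith
  · exact (not_lt.1 ht).trans (Real.exp_pos _).le

variable {n m : ℕ} {a : Fin m → ℝ} {p : Fin m → MvPolynomial (Fin n) ℝ}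

theorem objVal_le (ha : ∀ i, 0 < a i) {y : (Fin n →₀ ℕ) → ℝ} {b : Fin m → ℝ}
    (h : ∀ i, pairing (p i) y ≤ b i) :
    objVal a p y ≤ ((∑ i, a i * Real.log (b i) : ℝ) : EReal) := by
  have hcoe : ((∑ i, a i * Real.log (b i) : ℝ) : EReal) =
      ∑ i, (a i : EReal) * (Real.log (b i) : ℝ) := by
    simp only [← EReal.coe_mul]
    exact map_sum (AddMonoidHom.mk ⟨((↑) : ℝ → EReal), EReal.coe_zero⟩ EReal.coe_add) _ _
  rw [hcoe]
  exact sum_le_sum fun i _ => mul_le_mul_of_nonneg_left (elog_le_coe_log (h i))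
    (by exact_mod_cast (ha i).le)

theorem fMax_le_fMomK {K : Set (Fin n → ℝ)} {Eqs Ineqs : Set (MvPolynomial (Fin n) ℝ)}
    (hE : ∀ x ∈ K, ∀ c ∈ Eqs, eval x c = 0) (hI : ∀ x ∈ K, ∀ c ∈ Ineqs, 0 ≤ eval x c) (k : ℕ) :
    fMax a p K ≤ fMomK a p Eqs Ineqs k := by
  refine sSup_le ?_
  rintro _ ⟨x, hx, rfl⟩
  refine le_sSup ⟨diracMoments x, momFeasible_diracMoments (hE x hx) (hI x hx) k, ?_⟩
  simp only [objVal, fObj, ← momentFunctional_apply, momentFunctional_diracMoments]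

theorem eventually_fMomK_le {ι : Type*} [DecidableEq ι] {E I : Finset ι}
    {c : ι → MvPolynomial (Fin n) ℝ}
    (hArch : ∃ q ∈ idealQM E I c, IsCompact {x : Fin n → ℝ | 0 ≤ eval x q})
    (ha : ∀ i, 0 < a i) {b : Fin m → ℝ}
    (hp : ∀ i x, (∀ j ∈ E, eval x (c j) = 0) → (∀ j ∈ I, 0 ≤ eval x (c j)) →
      eval x (p i) < b i) :
    ∀ᶠ k in atTop, fMomK a p (c '' ↑E) (c '' ↑I) k ≤
      ((∑ i, a i * Real.log (b i) : ℝ) : EReal) := by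
  have hmem (i) : C (b i) - p i ∈ idealQM E I c :=
    mem_idealQM_of_forall_eval_pos hArch fun x hE hI => by
      simpa using hp i x hE hI
  filter_upwards [eventually_all.2 fun i => eventually_pairing_nonneg (hmem i)] with k hk
  refine sSup_le ?_
  rintro _ ⟨y, hy, rfl⟩
  refine objVal_le ha fun i => ?_
  have h := hk i y hy
  rw [map_sub, C_apply, momentFunctional_monomial, hy.1, mul_one, momentFunctional_apply] at h
  linarith

end Objective

/-- **Corollary 3.5.**  If `Ideal[c_E] + QM[c_I]` is Archimedean,
`K ≠ ∅`, and `f_max = f_γ` with the infimum defining `f_γ` attained, then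
`f_mom,k → f_max` as `k → ∞`. -/
theorem fMomK_tendsto_fMax
    {n m : ℕ} (hm : 1 ≤ m) {ι : Type*} [DecidableEq ι]
    (E I : Finset ι) (hEI : Disjoint E I)
    (c : ι → MvPolynomial (Fin n) ℝ)
    (K : Set (Fin n → ℝ))
    (hK : K = {x | (∀ j ∈ E, eval x (c j) = 0) ∧ ∀ j ∈ I, 0 ≤ eval x (c j)})
    (hKne : K.Nonempty)
    (a : Fin m → ℝ) (ha : ∀ i, 0 < a i)
    (p : Fin m → MvPolynomial (Fin n) ℝ)
    (hp : ∀ i, ∀ x ∈ K, 0 ≤ eval x (p i))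
    (d : ℕ)
    (hd : d = (Finset.univ.sup fun i => ceilHalf (p i).totalDegree) ⊔
      ((E ∪ I).sup fun j => ceilHalf (c j).totalDegree))
    (hArch : ∃ q ∈ idealQM E I c, IsCompact {x : Fin n → ℝ | 0 ≤ eval x q})
    (heq : fMax a p K = fGamma a p K)
    (hattain : ∃ γ : Fin m → ℝ,
      (∀ i, ∀ x ∈ K, (a i : EReal) * elog (eval x (p i)) ≤ ((γ i : ℝ) : EReal)) ∧
      ((∑ i, γ i : ℝ) : EReal) = fGamma a p K) :
    Tendsto (fun k => fMomK a p (c '' ↑E) (c '' ↑I) k) atTop (𝓝 (fMax a p K)) := by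
  subst hK
  obtain ⟨γ, hγ, hsum⟩ := hattain
  refine tendsto_order.2 ⟨fun b hb => .of_forall fun k => hb.trans_le (fMax_le_fMomK ?_ ?_ k),
    fun b hb => ?_⟩
  · rintro x hx _ ⟨j, hj, rfl⟩
    exact hx.1 j hj
  · rintro x hx _ ⟨j, hj, rfl⟩
    exact hx.2 j hj
  · let B : ℝ → ℝ := fun ε => ∑ i, a i * Real.log (Real.exp (γ i / a i) + ε)
    have hB : Tendsto (fun ε => (B ε : EReal)) (𝓝[>] 0) (𝓝 (B 0)) := by
      refine (continuous_coe_real_ereal.tendsto _).comp (tendsto_nhdsWithin_of_tendsto_nhds ?_)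
      refine tendsto_finsetSum _ fun i _ => .const_mul _ (Tendsto.log ?_ ?_)
      · exact (continuous_const.add continuous_id).tendsto 0
      · simp [(Real.exp_pos _).ne']
    have hB0 : B 0 = ∑ i, γ i :=
      sum_congr rfl fun i _ => by rw [add_zero, Real.log_exp, mul_div_cancel₀ _ (ha i).ne']
    rw [hB0, hsum, ← heq] at hB
    obtain ⟨ε, hεb, hε⟩ := ((hB.eventually_lt_const hb).and self_mem_nhdsWithin).exists
    filter_upwards [eventually_fMomK_le (p := p) hArch ha
      (b := fun i => Real.exp (γ i / a i) + ε) fun i x hE hI => lt_add_of_le_of_pos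
        (le_exp_div_of_mul_elog_le (ha i) (hγ i x ⟨hE, hI⟩)) hε] with k hk
    exact hk.trans_lt hεb

end
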